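/- arXiv:2405.09727 — 3 statements merged into one kernel-verified Lean document; each statement's English description precedes it below -/
import Mathlib

section
/- Let 𝒞 be the set of maximal cliques of a binary undirected graphical model (so no member of 𝒞 is properly contained in another), let G_C be the complete hypergraph with node set C, and let G = ∪_{C∈𝒞} G_C be the corresponding UGM hypergraph. Then for every C ∈ 𝒞, every facet-defining inequality of the multilinear polytope MP(G_C) (regarded as an inequality in the coordinates z_p with p ⊆ C, |p| ≥ 1) is facet-defining for the multilinear polytope MP(G). -/
open Finset

/-- The multilinear set of the hypergraph with node set `Vset` and edge set `E`.
Points are indexed by `Finset V`: node coordinates are `z {v}`, edge coordinates `z e`. -/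
def MultilinearSet {V : Type} [DecidableEq V] (Vset : Finset V) (E : Finset (Finset V)) :
    Set (Finset V → ℝ) :=
  {z | ∃ x : V → ℝ, (∀ v ∈ Vset, x v = 0 ∨ x v = 1) ∧ (∀ v ∈ Vset, z {v} = x v) ∧
        ∀ e ∈ E, z e = ∏ v ∈ e, x v}

/-- The edge set of the UGM hypergraph of a clique family `𝒞`. -/
def ugmEdges {V : Type} [DecidableEq V] (𝒞 : Finset (Finset V)) : Finset (Finset V) :=
  𝒞.biUnion fun C => C.powerset.filter fun e => 2 ≤ e.card

/-- The inequality `∑_p a_p z_p ≤ b` is facet-defining for `P`: it is valid for `P` and the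
affine dimension of the face it induces is one less than the affine dimension of `P`. -/
def IsFacetDefining {V : Type} [Fintype V] [DecidableEq V]
    (P : Set (Finset V → ℝ)) (a : Finset V → ℝ) (b : ℝ) : Prop :=
  (∀ z ∈ P, (∑ p : Finset V, a p * z p) ≤ b) ∧
    Module.finrank ℝ (vectorSpan ℝ {z ∈ P | (∑ p : Finset V, a p * z p) = b}) + 1 =
      Module.finrank ℝ (vectorSpan ℝ P)

/-- indicator vector -/
noncomputable def chiV {V : Type} [DecidableEq V] (X : Finset V) : Finset V → ℝ :=
  fun p => if p ⊆ X then 1 else 0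

/-- coordinates of the hypergraph -/
def KK {V : Type} (𝒞 : Finset (Finset V)) (p : Finset V) : Prop :=
  (∃ D ∈ 𝒞, p ⊆ D) ∧ p.Nonempty

lemma mem_ms {V : Type} [DecidableEq V] (𝒞 : Finset (Finset V)) (z : Finset V → ℝ) :
    z ∈ MultilinearSet (𝒞.sup id) (ugmEdges 𝒞) ↔
      ∃ X : Finset V, ∀ p, KK 𝒞 p → z p = chiV X p := by
  classical
  constructor
  · rintro ⟨x, hx, hv, he⟩
    refine ⟨(𝒞.sup id).filter (fun v => x v = 1), ?_⟩
    rintro p ⟨⟨D, hD, hpD⟩, hp⟩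
    have hsub : ∀ v ∈ p, v ∈ 𝒞.sup id := fun v hvp => by
      rw [Finset.mem_sup]; exact ⟨D, hD, hpD hvp⟩
    have h1 : z p = ∏ v ∈ p, x v := by
      by_cases hc : 2 ≤ p.card
      · apply he
        simp only [ugmEdges, mem_biUnion, mem_filter, mem_powerset]
        exact ⟨D, hD, hpD, hc⟩
      · have : p.card = 1 := by
          have := hp.card_pos
          omega
        obtain ⟨v, rfl⟩ := Finset.card_eq_one.1 this
        rw [hv v (hsub v (by simp))]; simp
    rw [h1]
    unfold chiV
    split_ifs with h
    · apply Finset.prod_eq_one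
      intro v hvp
      exact (Finset.mem_filter.1 (h hvp)).2
    · obtain ⟨v, hvp, hvn⟩ := Finset.not_subset.1 h
      apply Finset.prod_eq_zero hvp
      rcases hx v (hsub v hvp) with h0 | h0
      · exact h0
      · exact absurd (Finset.mem_filter.2 ⟨hsub v hvp, h0⟩) hvn
  · rintro ⟨X, hX⟩
    refine ⟨fun v => if v ∈ X then 1 else 0, ?_, ?_, ?_⟩
    · intro v _
      by_cases h : v ∈ X <;> simp [h]
    · intro v hv
      rw [Finset.mem_sup] at hv
      obtain ⟨D, hD, hvD⟩ := hv
      rw [hX _ ⟨⟨D, hD, by simpa using hvD⟩, by simp⟩]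
      simp [chiV]
    · intro e he
      simp only [ugmEdges, mem_biUnion, mem_filter, mem_powerset] at he
      obtain ⟨D, hD, heD, hc⟩ := he
      rw [hX _ ⟨⟨D, hD, heD⟩, Finset.card_pos.1 (by omega)⟩]
      rw [Finset.prod_ite_zero]
      simp only [chiV, Finset.subset_iff, Finset.prod_const_one]

lemma sum_Icc_neg {V : Type} [DecidableEq V] (u P : Finset V) :
    ∑ W ∈ P.powerset.filter (fun W => u ⊆ W), (-1 : ℝ) ^ W.card
      = if u = P then (-1) ^ P.card else 0 := by
  by_cases h : u ⊆ P
  · have h1 : P.powerset.filter (fun W => u ⊆ W) = (P \ u).powerset.image (u ∪ ·) := by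
      ext W
      simp only [mem_filter, mem_powerset, mem_image]
      constructor
      · rintro ⟨hW, hu⟩
        exact ⟨W \ u, Finset.sdiff_subset_sdiff hW le_rfl, Finset.union_sdiff_of_subset hu⟩
      · rintro ⟨T, hT, rfl⟩
        exact ⟨Finset.union_subset h (hT.trans Finset.sdiff_subset), Finset.subset_union_left⟩
    have hdis : ∀ T ∈ (P \ u).powerset, Disjoint u T := by
      intro T hT
      rw [mem_powerset] at hT
      exact (Finset.disjoint_sdiff).mono_right hT
    rw [h1, Finset.sum_image]
    · have h2 : ∀ T ∈ (P \ u).powerset, (-1 : ℝ) ^ (u ∪ T).card = (-1) ^ u.card * (-1) ^ T.card := by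
        intro T hT
        rw [Finset.card_union_of_disjoint (hdis T hT), pow_add]
      rw [Finset.sum_congr rfl h2, ← Finset.mul_sum]
      have h3 := Finset.sum_powerset_neg_one_pow_card (x := P \ u)
      have h4 : ∑ T ∈ (P \ u).powerset, (-1 : ℝ) ^ T.card = if P \ u = ∅ then 1 else 0 := by
        have := congrArg (Int.cast : ℤ → ℝ) h3
        push_cast at this
        exact this
      rw [h4]
      by_cases hu : u = P
      · simp [hu]
      · have : P \ u ≠ ∅ := fun hh => hu (Finset.Subset.antisymm h (Finset.sdiff_eq_empty_iff_subset.1 hh))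
        simp [hu, this]
    · intro T hT T' hT' heq
      have a1 := hdis T hT
      have a2 := hdis T' hT'
      have := congrArg (· \ u) heq
      simpa [Finset.union_sdiff_distrib, Finset.sdiff_eq_self_of_disjoint a1.symm,
        Finset.sdiff_eq_self_of_disjoint a2.symm] using this
  · have : P.powerset.filter (fun W => u ⊆ W) = ∅ := by
      ext W
      simp only [mem_filter, mem_powerset, notMem_empty, iff_false, not_and]
      exact fun hW hu => h (hu.trans hW)
    rw [this, if_neg (fun hh : u = P => h (hh ▸ le_rfl))]
    simp

lemma moeb {V : Type} [Fintype V] [DecidableEq V] (c : Finset V → ℝ) (P : Finset V) :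
    ∑ X ∈ P.powerset, (-1 : ℝ) ^ X.card * (∑ p, c p * chiV X p) = (-1) ^ P.card * c P := by
  simp_rw [Finset.mul_sum]
  rw [Finset.sum_comm]
  have : ∀ p : Finset V, ∑ X ∈ P.powerset, (-1 : ℝ) ^ X.card * (c p * chiV X p)
      = c p * (if p = P then (-1) ^ P.card else 0) := by
    intro p
    rw [← sum_Icc_neg, Finset.sum_filter, Finset.mul_sum]
    apply Finset.sum_congr rfl
    intro X _
    unfold chiV
    split_ifs <;> ring
  simp_rw [this]
  simp [mul_comm]

lemma span_top {V : Type} [Fintype V] [DecidableEq V] (𝒞 : Finset (Finset V))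
    (hmax : ∀ C ∈ 𝒞, ∀ C' ∈ 𝒞, C ⊆ C' → C = C')
    (C : Finset V) (hC : C ∈ 𝒞) (hne : C.Nonempty) (u : Finset V) (hu : u ⊆ C)
    (A : Set (Finset V → ℝ))
    (hA : ∀ (z : Finset V → ℝ) (X : Finset V), (∀ p, KK 𝒞 p → z p = chiV X p) → X ∩ C ≠ u → z ∈ A)
    (huA : chiV u ∈ A) : vectorSpan ℝ A = ⊤ := by
  by_contra hcon
  obtain ⟨f, hf0, hf⟩ := Submodule.exists_le_ker_of_lt_top _ (lt_top_iff_ne_top.2 hcon)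
  have hconst : ∀ z ∈ A, f z = f (chiV u) := by
    intro z hz
    have := hf (vsub_mem_vectorSpan ℝ hz huA)
    rw [LinearMap.mem_ker, vsub_eq_sub, map_sub, sub_eq_zero] at this
    exact this
  obtain ⟨c, hc⟩ : ∃ c : Finset V → ℝ, ∀ p, c p = f (Pi.single p 1) := ⟨_, fun _ => rfl⟩
  have hfc : ∀ z, f z = ∑ p, c p * z p := by
    intro z
    rw [LinearMap.pi_apply_eq_sum_univ f z]
    apply Finset.sum_congr rfl
    intro p _
    rw [hc, smul_eq_mul, mul_comm]
    congr 2
    ext q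
    simp [Pi.single_apply, eq_comm]
  obtain ⟨u', hu'C, hu'⟩ : ∃ u', u' ⊆ C ∧ u' ≠ u := by
    by_cases h : u = ∅
    · exact ⟨C, le_rfl, by rw [h]; exact hne.ne_empty⟩
    · exact ⟨∅, by simp, fun hh => h hh.symm⟩
  have hfree : ∀ p, ¬ KK 𝒞 p → c p = 0 := by
    intro p hp
    have hi : u' ∩ C ≠ u := by rwa [Finset.inter_eq_left.2 hu'C]
    have h1 := hconst (chiV u') (hA _ u' (fun _ _ => rfl) hi)
    have h2 := hconst (chiV u' + Pi.single p 1) (hA _ u' (fun q hq => by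
      have : q ≠ p := fun h => hp (h ▸ hq)
      simp [this]) hi)
    rw [map_add, ← hc] at h2
    linarith
  set d := f (chiV u) with hd
  let c' : Finset V → ℝ := fun p => c p - if p = ∅ then d else 0
  have hg : ∀ X, ∑ p, c' p * chiV X p = f (chiV X) - d := by
    intro X
    simp only [c', sub_mul, Finset.sum_sub_distrib, ← hfc]
    have : ∀ p : Finset V, (if p = ∅ then d else 0) * chiV X p = if p = ∅ then d else 0 := by
      intro p
      by_cases hp : p = ∅
      · simp [hp, chiV]
      · simp [hp]
    simp [this]
  have key : ∀ q : Finset V, Disjoint q C → f (chiV (u ∪ q)) - d = 0 := by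
    intro q
    induction q using Finset.strongInduction with
    | H q ih =>
      intro hq
      by_cases hq0 : q = ∅
      · simp [hq0, hd]
      have hP : ¬ KK 𝒞 (C ∪ q) := by
        rintro ⟨⟨D, hD, hsub⟩, _⟩
        have := hmax C hC D hD (Finset.subset_union_left.trans hsub)
        subst this
        have hqC : q ⊆ C := Finset.subset_union_right.trans hsub
        exact hq0 (Finset.disjoint_self_iff_empty _ |>.1 (hq.mono_right hqC))
      have h0 : c' (C ∪ q) = 0 := by
        have : C ∪ q ≠ ∅ := fun h => hq0 (Finset.union_eq_empty.1 h).2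
        simp [c', this, hfree _ hP]
      have hm := moeb c' (C ∪ q)
      rw [h0, mul_zero, Finset.sum_eq_single (u ∪ q)] at hm
      · rw [hg] at hm
        exact (mul_eq_zero.1 hm).resolve_left (by simp)
      · intro X hX hXne
        rw [hg]
        rw [mem_powerset] at hX
        by_cases hXu : X ∩ C = u
        · have hXe : X = u ∪ (X \ C) := by
            rw [← hXu]; ext v; simp; tauto
          have hsub : X \ C ⊆ q := by
            intro v hv
            rw [mem_sdiff] at hv
            exact (Finset.mem_union.1 (hX hv.1)).resolve_left hv.2
          have hss : X \ C ⊂ q := by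
            refine hsub.ssubset_of_ne ?_
            intro h
            rw [h] at hXe
            exact hXne hXe
          rw [hXe, ih _ hss Finset.sdiff_disjoint, mul_zero]
        · rw [hconst _ (hA _ X (fun _ _ => rfl) hXu), sub_self, mul_zero]
      · intro h
        exact absurd (mem_powerset.2 (Finset.union_subset_union hu le_rfl)) h
  have hall : ∀ X, f (chiV X) - d = 0 := by
    intro X
    by_cases hXu : X ∩ C = u
    · have hXe : X = u ∪ (X \ C) := by
        rw [← hXu]; ext v; simp; tauto
      rw [hXe]
      exact key _ Finset.sdiff_disjoint
    · rw [hconst _ (hA _ X (fun _ _ => rfl) hXu), sub_self]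
  have hc0 : ∀ p, c p = 0 := by
    intro p
    by_cases hp : p = ∅
    · apply hfree
      rintro ⟨_, h⟩
      exact h.ne_empty hp
    · have hm := moeb c' p
      simp only [hg, hall, mul_zero, Finset.sum_const_zero] at hm
      have := (mul_eq_zero.1 hm.symm).resolve_left (by simp)
      simpa [c', hp] using this
  apply hf0
  ext1 p
  ext
  simp [← hc, hc0]

lemma finrank_step {ι : Type} [Fintype ι] (F : Set (ι → ℝ)) (hF : F.Nonempty)
    (f : (ι → ℝ) →ₗ[ℝ] ℝ) (k : ℝ) (hf : ∀ z ∈ F, f z = k) (z : ι → ℝ) (hz : f z ≠ k) :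
    Module.finrank ℝ (vectorSpan ℝ F) + 1 ≤ Module.finrank ℝ (vectorSpan ℝ (insert z F)) := by
  apply Submodule.finrank_lt_finrank_of_lt
  refine lt_of_le_of_ne (vectorSpan_mono ℝ (Set.subset_insert _ _)) ?_
  intro heq
  obtain ⟨y, hy⟩ := hF
  have h1 : z -ᵥ y ∈ vectorSpan ℝ F := by
    rw [heq]
    exact vsub_mem_vectorSpan ℝ (Set.mem_insert _ _) (Set.mem_insert_of_mem _ hy)
  have h2 : vectorSpan ℝ F ≤ LinearMap.ker f := by
    rw [vectorSpan, Submodule.span_le]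
    rintro _ ⟨p, hp, q, hq, rfl⟩
    simp [hf p hp, hf q hq]
  have := h2 h1
  rw [LinearMap.mem_ker, vsub_eq_sub, map_sub, hf y hy] at this
  exact hz (by linarith)

/-- dot product as a linear map -/
noncomputable def LL {ι : Type} [Fintype ι] (w : ι → ℝ) : (ι → ℝ) →ₗ[ℝ] ℝ :=
  ∑ p, w p • LinearMap.proj p

lemma LL_apply {ι : Type} [Fintype ι] (w z : ι → ℝ) : LL w z = ∑ p, w p * z p := by
  simp [LL, LinearMap.sum_apply]

lemma hull_le {ι : Type} [Fintype ι] (S : Set (ι → ℝ)) (f : (ι → ℝ) →ₗ[ℝ] ℝ) (k : ℝ)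
    (h : ∀ z ∈ S, f z ≤ k) : ∀ z ∈ convexHull ℝ S, f z ≤ k := by
  intro z hz
  exact convexHull_min (t := {z | f z ≤ k}) h (convex_halfSpace_le f.isLinear k) hz

/-- psi functional -/
lemma exists_psi {V : Type} [Fintype V] [DecidableEq V] (C u : Finset V) (hu : u ⊆ C) :
    ∃ (f : (Finset V → ℝ) →ₗ[ℝ] ℝ) (k : ℝ), ∀ (z : Finset V → ℝ) (X : Finset V),
      (∀ p, KK {C} p → z p = chiV X p) → f z = k + if X ∩ C = u then 1 else 0 := by
  let m : Finset V → ℝ := fun W => if u ⊆ W ∧ W ⊆ C then (-1) ^ (W.card + u.card) else 0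
  refine ⟨LL (fun W => if W = ∅ then 0 else m W), - m ∅, ?_⟩
  intro z X h
  have h1 : ∑ W, m W * chiV X W = if X ∩ C = u then 1 else 0 := by
    have h2 := sum_Icc_neg u (X ∩ C)
    have h3 : ∑ W, m W * chiV X W = (-1) ^ u.card *
        ∑ W ∈ (X ∩ C).powerset.filter (fun W => u ⊆ W), (-1 : ℝ) ^ W.card := by
      rw [Finset.mul_sum, ← Finset.sum_filter_add_sum_filter_not (s := Finset.univ)
        (p := fun W => W ⊆ X ∩ C ∧ u ⊆ W)]
      rw [Finset.sum_eq_zero (s := Finset.univ.filter (fun W => ¬ (W ⊆ X ∩ C ∧ u ⊆ W))), add_zero]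
      · apply Finset.sum_congr
        · ext W; simp only [mem_filter, mem_univ, true_and, mem_powerset]
        · intro W hW
          simp only [mem_filter, mem_powerset, subset_inter_iff] at hW
          simp [m, chiV, hW.1.1, hW.1.2, hW.2, pow_add, mul_comm]
      · intro W hW
        simp only [mem_filter, mem_univ, true_and, subset_inter_iff] at hW
        simp only [m, chiV]
        split_ifs <;> first | (exfalso; tauto) | simp
    rw [h3, h2]
    by_cases hh : X ∩ C = u
    · simp [hh, ← pow_add, ← two_mul]
    · rw [if_neg hh, if_neg (fun h => hh (Eq.symm h)), mul_zero]
  rw [← h1, LL_apply]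
  have h4 : - m ∅ = - ∑ W : Finset V, (if W = ∅ then m ∅ else 0) := by simp
  rw [h4, ← Finset.sum_neg_distrib, ← Finset.sum_add_distrib]
  apply Finset.sum_congr rfl
  intro W _
  by_cases hW : W = ∅
  · subst hW; simp [chiV]
  · simp only [hW, if_false]
    by_cases hWC : W ⊆ C
    · rw [h W ⟨⟨C, by simp, hWC⟩, Finset.nonempty_iff_ne_empty.2 hW⟩]; simp
    · simp [m, hWC]

lemma two_untight {V : Type} [Fintype V] [DecidableEq V] (C : Finset V)
    (a : Finset V → ℝ) (b : ℝ)
    (hsupp : ∀ p : Finset V, a p ≠ 0 → p ⊆ C ∧ p.Nonempty)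
    (hfacet : IsFacetDefining
      (convexHull ℝ (MultilinearSet (({C} : Finset (Finset V)).sup id) (ugmEdges {C}))) a b)
    (u₁ u₂ : Finset V) (h₁ : u₁ ⊆ C) (h₂ : u₂ ⊆ C) (hne : u₁ ≠ u₂)
    (ht₁ : ∑ p, a p * chiV u₁ p ≠ b) (ht₂ : ∑ p, a p * chiV u₂ p ≠ b) : False := by
  set S := MultilinearSet (({C} : Finset (Finset V)).sup id) (ugmEdges {C}) with hS
  obtain ⟨hval, hdim⟩ := hfacet
  have hmem : ∀ X, chiV X ∈ S := fun X => (mem_ms _ _).2 ⟨X, fun _ _ => rfl⟩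
  have hP : S ⊆ convexHull ℝ S := subset_convexHull ℝ S
  have hzero : ∀ u, u ⊆ C → ∑ p, a p * chiV u p ≠ b →
      ∀ (f : (Finset V → ℝ) →ₗ[ℝ] ℝ) (k : ℝ), (∀ (z : Finset V → ℝ) (X : Finset V),
      (∀ p, KK {C} p → z p = chiV X p) → f z = k + if X ∩ C = u then 1 else 0) →
      ∀ z ∈ {z ∈ convexHull ℝ S | (∑ p : Finset V, a p * z p) = b}, f z = k := by
    rintro u hu ht f k hf z ⟨hz, hzb⟩
    have hlt : ∑ p, a p * chiV u p < b := lt_of_le_of_ne (hval _ (hP (hmem u))) ht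
    apply le_antisymm
    · have := hull_le S ((b - ∑ p, a p * chiV u p) • f + LL a)
        (b + (b - ∑ p, a p * chiV u p) * k) (by
          intro y hy
          have hyb := hval y (hP hy)
          obtain ⟨X, hX⟩ := (mem_ms _ _).1 hy
          simp only [LinearMap.add_apply, LinearMap.smul_apply, LL_apply, smul_eq_mul]
          rw [hf y X hX]
          split_ifs with h
          · have : ∑ p, a p * y p = ∑ p, a p * chiV u p := by
              apply Finset.sum_congr rfl
              intro p _
              by_cases hap : a p = 0
              · simp [hap]
              · obtain ⟨hpC, hpn⟩ := hsupp p hap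
                rw [hX p ⟨⟨C, by simp, hpC⟩, hpn⟩, ← h]
                simp [chiV, Finset.subset_inter_iff, hpC]
            rw [this]
            linarith
          · linarith) z hz
      simp only [LinearMap.add_apply, LinearMap.smul_apply, LL_apply, smul_eq_mul, hzb] at this
      have h5 : (b - ∑ p, a p * chiV u p) * (f z) ≤ (b - ∑ p, a p * chiV u p) * k := by linarith
      exact le_of_mul_le_mul_left h5 (by linarith)
    · have := hull_le S (-f) (-k) (by
          intro y hy
          obtain ⟨X, hX⟩ := (mem_ms _ _).1 hy
          rw [LinearMap.neg_apply, hf y X hX]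
          split_ifs <;> linarith) z hz
      rw [LinearMap.neg_apply] at this
      linarith
  obtain ⟨f₁, k₁, hf₁⟩ := exists_psi C u₁ h₁
  obtain ⟨f₂, k₂, hf₂⟩ := exists_psi C u₂ h₂
  have e1 : f₁ (chiV u₁) ≠ k₁ := by
    rw [hf₁ _ u₁ (fun _ _ => rfl), Finset.inter_eq_left.2 h₁]; simp
  have e2 : f₂ (chiV u₂) ≠ k₂ := by
    rw [hf₂ _ u₂ (fun _ _ => rfl), Finset.inter_eq_left.2 h₂]; simp
  have e3 : f₂ (chiV u₁) = k₂ := by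
    rw [hf₂ _ u₁ (fun _ _ => rfl), Finset.inter_eq_left.2 h₁]; simp [hne]
  set F := {z ∈ convexHull ℝ S | (∑ p : Finset V, a p * z p) = b} with hFdef
  rcases F.eq_empty_or_nonempty with hF | hF
  · rw [hF] at hdim
    have hz0 : Module.finrank ℝ (vectorSpan ℝ (∅ : Set (Finset V → ℝ))) = 0 := by
      rw [vectorSpan_empty]; exact finrank_bot ℝ _
    rw [hz0] at hdim
    have hfree : ∀ p, KK {C} p → (chiV u₁ + Pi.single ∅ 1 : Finset V → ℝ) p = chiV u₁ p := by
      intro p hp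
      have : p ≠ ∅ := hp.2.ne_empty
      simp [this]
    have s1 := finrank_step {chiV u₁} (Set.singleton_nonempty _) (LinearMap.proj ∅)
      (chiV u₁ ∅) (by simp) (chiV u₁ + Pi.single ∅ 1) (by simp)
    have s2 := finrank_step (insert (chiV u₁ + Pi.single ∅ 1) {chiV u₁})
      (Set.insert_nonempty _ _) f₂ k₂ (by
        intro z hz
        rcases hz with rfl | rfl
        · rw [hf₂ _ u₁ hfree, Finset.inter_eq_left.2 h₁]; simp [hne]
        · exact e3) (chiV u₂) e2
    have s3 := Submodule.finrank_mono (vectorSpan_mono ℝ (show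
      (insert (chiV u₂) (insert (chiV u₁ + Pi.single ∅ 1) {chiV u₁})) ⊆ convexHull ℝ S by
        intro z hz
        apply hP
        rcases hz with rfl | rfl | rfl
        · exact hmem _
        · exact (mem_ms _ _).2 ⟨u₁, hfree⟩
        · exact hmem _))
    omega
  · have s1 := finrank_step F hF f₁ k₁ (hzero u₁ h₁ ht₁ f₁ k₁ hf₁) (chiV u₁) e1
    have s2 := finrank_step (insert (chiV u₁) F) (Set.insert_nonempty _ _) f₂ k₂ (by
        intro z hz
        rcases hz with rfl | hz
        · exact e3
        · exact hzero u₂ h₂ ht₂ f₂ k₂ hf₂ z hz) (chiV u₂) e2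
    have s3 := Submodule.finrank_mono (vectorSpan_mono ℝ (show
      (insert (chiV u₂) (insert (chiV u₁) F)) ⊆ convexHull ℝ S by
        intro z hz
        rcases hz with rfl | rfl | hz
        · exact hP (hmem _)
        · exact hP (hmem _)
        · exact hz.1))
    omega


/-- if `𝒞` is a family of maximal cliques (no member properly contained in
another), then every facet-defining inequality of the multilinear polytope of the complete
hypergraph `G_C`, `C ∈ 𝒞` (an inequality in the coordinates `z_p`, `∅ ≠ p ⊆ C`), is
facet-defining for the multilinear polytope of the UGM hypergraph `G = ∪_{C ∈ 𝒞} G_C`. -/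
theorem facets_of_clique_polytopes_are_facets {V : Type} [Fintype V] [DecidableEq V]
    (𝒞 : Finset (Finset V))
    (hmax : ∀ C ∈ 𝒞, ∀ C' ∈ 𝒞, C ⊆ C' → C = C')
    (C : Finset V) (hC : C ∈ 𝒞)
    (a : Finset V → ℝ) (b : ℝ)
    (hsupp : ∀ p : Finset V, a p ≠ 0 → p ⊆ C ∧ p.Nonempty)
    (hfacet : IsFacetDefining
      (convexHull ℝ (MultilinearSet C (C.powerset.filter fun e => 2 ≤ e.card))) a b) :
    IsFacetDefining
      (convexHull ℝ (MultilinearSet (𝒞.sup id) (ugmEdges 𝒞))) a b := by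
  have e1 : MultilinearSet C (C.powerset.filter fun e => 2 ≤ e.card)
      = MultilinearSet (({C} : Finset (Finset V)).sup id) (ugmEdges {C}) := by
    simp [ugmEdges]
  rw [e1] at hfacet
  by_cases hCe : C = ∅
  · have : 𝒞 = {C} := by
      ext D
      simp only [mem_singleton]
      constructor
      · intro hD
        exact (hmax C hC D hD (by simp [hCe])).symm
      · rintro rfl
        exact hC
    rw [this]
    exact hfacet
  have hne : C.Nonempty := Finset.nonempty_iff_ne_empty.2 hCe
  have hu : ∃ u ⊆ C, ∀ u' ⊆ C, u' ≠ u → ∑ p, a p * chiV u' p = b := by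
    by_cases h : ∃ u ⊆ C, ∑ p, a p * chiV u p ≠ b
    · obtain ⟨u, hu, ht⟩ := h
      refine ⟨u, hu, fun u' hu' hne' => ?_⟩
      by_contra hcon
      exact two_untight C a b hsupp hfacet u' u hu' hu hne' hcon ht
    · push Not at h
      exact ⟨∅, by simp, fun u' hu' _ => h u' hu'⟩
  obtain ⟨u, hu, htight⟩ := hu
  obtain ⟨hval, hdim⟩ := hfacet
  set SC := MultilinearSet (({C} : Finset (Finset V)).sup id) (ugmEdges {C}) with hSC
  set S := MultilinearSet (𝒞.sup id) (ugmEdges 𝒞) with hS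
  have hsub : S ⊆ SC := by
    intro z hz
    obtain ⟨X, hX⟩ := (mem_ms _ _).1 hz
    refine (mem_ms _ _).2 ⟨X, fun p hp => hX p ⟨⟨C, hC, ?_⟩, hp.2⟩⟩
    obtain ⟨⟨D, hD, hpD⟩, _⟩ := hp
    rw [mem_singleton] at hD
    exact hD ▸ hpD
  have hPsub : convexHull ℝ S ⊆ convexHull ℝ SC := convexHull_mono hsub
  refine ⟨fun z hz => hval z (hPsub hz), ?_⟩
  set F := {z ∈ convexHull ℝ S | (∑ p : Finset V, a p * z p) = b} with hF
  have huS : chiV u ∈ S := (mem_ms _ _).2 ⟨u, fun _ _ => rfl⟩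
  have htop : vectorSpan ℝ (insert (chiV u) F) = ⊤ := by
    refine span_top 𝒞 hmax C hC hne u hu _ ?_ (Set.mem_insert _ _)
    intro z X hX hXu
    refine Set.mem_insert_of_mem _ ⟨subset_convexHull ℝ S ((mem_ms _ _).2 ⟨X, hX⟩), ?_⟩
    rw [← htight (X ∩ C) Finset.inter_subset_right hXu]
    apply Finset.sum_congr rfl
    intro p _
    by_cases hap : a p = 0
    · simp [hap]
    · obtain ⟨hpC, hpn⟩ := hsupp p hap
      rw [hX p ⟨⟨C, hC, hpC⟩, hpn⟩]
      simp [chiV, Finset.subset_inter_iff, hpC]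
  have hPtop : vectorSpan ℝ (convexHull ℝ S) = ⊤ := by
    rw [eq_top_iff, ← htop]
    apply vectorSpan_mono
    intro z hz
    rcases hz with rfl | hz
    · exact subset_convexHull ℝ S huS
    · exact hz.1
  have hPCtop : vectorSpan ℝ (convexHull ℝ SC) = ⊤ := by
    rw [eq_top_iff, ← hPtop]
    exact vectorSpan_mono ℝ hPsub
  have l1 := finrank_vectorSpan_insert_le_set ℝ F (chiV u)
  have l2 := Submodule.finrank_mono (vectorSpan_mono ℝ (show
    F ⊆ {z ∈ convexHull ℝ SC | (∑ p : Finset V, a p * z p) = b} from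
      fun z hz => ⟨hPsub hz.1, hz.2⟩))
  rw [htop] at l1
  rw [hPCtop] at hdim
  rw [hPtop]
  omega
end

section
/- Let 𝒞 = {C_1,…,C_m}, m ≥ 3, be a lifted cycle of cliques: |C_i| ≥ 3 for all i, there is a common node v̄ and distinct nodes v_1,…,v_m such that C_i ∩ C_{i+1} = {v_i, v̄} for all i ∈ [m] (indices modulo m, C_{m+1} := C_1), and C_i ∩ C_j = {v̄} for all nonconsecutive i ≠ j. Let G_{C_i} be the complete hypergraph with node set C_i, let G_𝒞 = ∪_{i∈[m]} G_{C_i}, and let K be the cycle with edges {v_i, v_{i+1}} for i ∈ [m] (with v_{m+1} := v_1). Then the multilinear polytope MP(G_𝒞) equals the set of points z such that (a) for each i ∈ [m] the restriction of z to coordinates indexed by nonempty subsets of C_i lies in MP(G_{C_i}), and (b) z satisfies, for every D ⊆ K with |D| odd, the two lifted odd-cycle inequalities: ∑_{v∈V_1(D)} z_{{v,v̄}} − ∑_{v∈V_2(D)} z_{{v,v̄}} − ∑_{e∈D} z_{e∪{v̄}} + ∑_{e∈K\D} z_{e∪{v̄}} ≤ ⌊|D|/2⌋ z_{v̄}, and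 ∑_{v∈V_1(D)} (z_v − z_{{v,v̄}}) − ∑_{v∈V_2(D)} (z_v − z_{{v,v̄}}) − ∑_{e∈D} (z_e − z_{e∪{v̄}}) + ∑_{e∈K\D} (z_e − z_{e∪{v̄}}) ≤ ⌊|D|/2⌋ (1 − z_{v̄}), where V_1(D) := (∪_{e∈D} e) \ (∪_{e∈K\D} e) and V_2(D) := V(K) \ (∪_{e∈D} e), and V(K) = {v_1,…,v_m}. -/
open Finset

/-- moment functions of nonnegative measures on the subsets of `V` -/
def IsMom {V : Type} [Fintype V] [DecidableEq V] (g : Finset V → ℝ) : Prop :=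
  ∃ h : Finset V → ℝ, (∀ T, 0 ≤ h T) ∧ ∀ S, g S = ∑ T, if S ⊆ T then h T else 0

section Mom
variable {V : Type} [Fintype V] [DecidableEq V]

lemma IsMom.of_sum {ι : Type*} [Fintype ι] (c : ι → ℝ) (hc : ∀ i, 0 ≤ c i)
    (T : ι → Finset V) : IsMom (fun S => ∑ i, if S ⊆ T i then c i else 0) := by
  refine ⟨fun U => ∑ i, if T i = U then c i else 0, fun U => ?_, fun S => ?_⟩
  · exact Finset.sum_nonneg fun i _ => by split_ifs <;> simp [hc]
  · have : ∀ U : Finset V, (if S ⊆ U then (∑ i, if T i = U then c i else 0) else 0)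
        = ∑ i, if T i = U then (if S ⊆ U then c i else 0) else 0 := by
      intro U
      split_ifs <;> simp
    simp only [this]
    rw [Finset.sum_comm]
    simp

lemma IsMom.comb {f g : Finset V → ℝ} (hf : IsMom f) (hg : IsMom g) {a b : ℝ}
    (ha : 0 ≤ a) (hb : 0 ≤ b) : IsMom (fun S => a * f S + b * g S) := by
  obtain ⟨h1, p1, e1⟩ := hf
  obtain ⟨h2, p2, e2⟩ := hg
  refine ⟨fun T => a * h1 T + b * h2 T, fun T => ?_, fun S => ?_⟩
  · have := p1 T
    have := p2 T
    positivity
  · dsimp only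
    rw [e1, e2, Finset.mul_sum, Finset.mul_sum, ← Finset.sum_add_distrib]
    refine Finset.sum_congr rfl fun T _ => ?_
    split_ifs <;> simp

lemma IsMom.add {f g : Finset V → ℝ} (hf : IsMom f) (hg : IsMom g) :
    IsMom (fun S => f S + g S) := by
  simpa using hf.comb hg (a := 1) (b := 1) (by norm_num) (by norm_num)

lemma IsMom.ins {g : Finset V → ℝ} (hg : IsMom g) (b : V) :
    IsMom (fun S => g (insert b S)) := by
  obtain ⟨h, p, e⟩ := hg
  refine ⟨fun T => if b ∈ T then h T else 0, fun T => by dsimp only; split_ifs <;> simp [p], fun S => ?_⟩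
  simp only [e]
  refine Finset.sum_congr rfl fun T _ => ?_
  by_cases h1 : b ∈ T <;> by_cases h2 : S ⊆ T <;> simp [h1, h2, Finset.insert_subset_iff]

lemma IsMom.del {g : Finset V → ℝ} (hg : IsMom g) (b : V) :
    IsMom (fun S => g S - g (insert b S)) := by
  obtain ⟨h, p, e⟩ := hg
  refine ⟨fun T => if b ∈ T then 0 else h T, fun T => by dsimp only; split_ifs <;> simp [p], fun S => ?_⟩
  simp only [e, ← Finset.sum_sub_distrib]
  refine Finset.sum_congr rfl fun T _ => ?_
  by_cases h1 : b ∈ T <;> by_cases h2 : S ⊆ T <;> simp [h1, h2, Finset.insert_subset_iff]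

/-- place `b` always in -/
lemma IsMom.pushIns {g : Finset V → ℝ} (hg : IsMom g) (b : V) :
    IsMom (fun S => g (S.erase b)) := by
  obtain ⟨h, p, e⟩ := hg
  have := IsMom.of_sum h p (fun T => insert b T)
  convert this using 2 with S
  rw [e]
  refine Finset.sum_congr rfl fun T _ => ?_
  simp [Finset.subset_insert_iff]

lemma IsMom.pushDel {g : Finset V → ℝ} (hg : IsMom g) (b : V) :
    IsMom (fun S => if b ∈ S then 0 else g S) := by
  obtain ⟨h, p, e⟩ := hg
  have := IsMom.of_sum h p (fun T => T.erase b)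
  convert this using 2 with S
  rw [e]
  by_cases hb : b ∈ S
  · simp [hb, Finset.subset_erase]
  · simp [hb, Finset.subset_erase]

/-- Moments determine marginals. -/
lemma marg_eq (h1 h2 : Finset V → ℝ) (I : Finset V)
    (hmom : ∀ S ⊆ I, (∑ T, if S ⊆ T then h1 T else 0) = ∑ T, if S ⊆ T then h2 T else 0) :
    ∀ n : ℕ, ∀ S ⊆ I, (I \ S).card = n →
      (∑ T, if T ∩ I = S then h1 T else 0) = ∑ T, if T ∩ I = S then h2 T else 0 := by
  have key : ∀ (h : Finset V → ℝ) (S : Finset V), S ⊆ I → (∑ T, if S ⊆ T then h T else 0)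
      = (∑ T, if T ∩ I = S then h T else 0) +
        ∑ R ∈ I.powerset.filter (fun R => S ⊂ R), ∑ T, if T ∩ I = R then h T else 0 := by
    intro h S hS
    rw [Finset.sum_comm, ← Finset.sum_add_distrib]
    refine Finset.sum_congr rfl fun T _ => ?_
    rw [Finset.sum_ite_eq]
    have : S ⊆ T ↔ S ⊆ T ∩ I := by simp [Finset.subset_inter_iff, hS]
    by_cases h1 : T ∩ I = S
    · have h2 : S ⊆ T := h1 ▸ Finset.inter_subset_left
      simp [h1, h2]
    · by_cases h2 : S ⊆ T
      · have h3 : S ⊂ T ∩ I := lt_of_le_of_ne (this.1 h2) (Ne.symm h1)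
        simp [h1, h2, h3]
      · have h3 : ¬ S ⊂ T ∩ I := fun hh => h2 (this.2 hh.1)
        simp [h1, h2, h3]
  intro n
  induction n using Nat.strong_induction_on with
  | _ n ih =>
    intro S hS hn
    have e := hmom S hS
    rw [key h1 S hS, key h2 S hS] at e
    have : ∑ R ∈ I.powerset.filter (fun R => S ⊂ R), (∑ T, if T ∩ I = R then h1 T else 0)
        = ∑ R ∈ I.powerset.filter (fun R => S ⊂ R), ∑ T, if T ∩ I = R then h2 T else 0 := by
      refine Finset.sum_congr rfl fun R hR => ?_
      simp only [Finset.mem_filter, Finset.mem_powerset] at hR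
      refine ih (I \ R).card ?_ R hR.1 rfl
      rw [← hn]
      apply Finset.card_lt_card
      refine Finset.ssubset_iff_subset_ne.2 ⟨Finset.sdiff_subset_sdiff le_rfl hR.2.1, ?_⟩
      intro hh
      apply hR.2.2
      intro x hx
      by_contra hxS
      have : x ∈ I \ S := by simp [hR.1 hx, hxS]
      rw [← hh] at this
      simp [hx] at this
    linarith

/-- Gluing. -/
lemma glue {f g : Finset V → ℝ} (hf : IsMom f) (hg : IsMom g) (A B : Finset V)
    (hfg : ∀ S ⊆ A ∩ B, f S = g S) :
    ∃ k, IsMom k ∧ (∀ S ⊆ A, k S = f S) ∧ ∀ S ⊆ B, k S = g S := by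
  obtain ⟨h1, p1, e1⟩ := hf
  obtain ⟨h2, p2, e2⟩ := hg
  have hm : ∀ S ⊆ A ∩ B, (∑ T, if T ∩ (A ∩ B) = S then h1 T else 0)
      = ∑ T, if T ∩ (A ∩ B) = S then h2 T else 0 := by
    intro S hS
    refine marg_eq h1 h2 (A ∩ B) (fun S hS => ?_) _ S hS rfl
    rw [← e1, ← e2, hfg S hS]
  set I := A ∩ B with hI
  set H : Finset V → ℝ := fun S => ∑ T, if T ∩ I = S then h1 T else 0 with hH
  have H0 : ∀ S, 0 ≤ H S := fun S =>
    Finset.sum_nonneg fun T _ => by split_ifs <;> simp [p1]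
  let c : Finset V × Finset V → ℝ := fun P =>
    if P.1 ∩ I = P.2 ∩ I then h1 P.1 * h2 P.2 / H (P.1 ∩ I) else 0
  refine ⟨_, IsMom.of_sum c (fun P => ?_) (fun P => (P.1 ∩ A) ∪ (P.2 ∩ B)), ?_, ?_⟩
  · simp only [c]
    split_ifs
    · exact div_nonneg (mul_nonneg (p1 _) (p2 _)) (H0 _)
    · exact le_rfl
  · intro S hS
    rw [Fintype.sum_prod_type, e1]
    refine Finset.sum_congr rfl fun T1 _ => ?_
    have h3 : ∀ T2, (if S ⊆ T1 ∩ A ∪ T2 ∩ B then c (T1, T2) else 0)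
        = (if S ⊆ T1 then h1 T1 else 0) / H (T1 ∩ I) *
          (if T2 ∩ I = T1 ∩ I then h2 T2 else 0) := by
      intro T2
      by_cases hT : T1 ∩ I = T2 ∩ I
      · have : S ⊆ T1 ∩ A ∪ T2 ∩ B ↔ S ⊆ T1 := by
          rw [Finset.ext_iff] at hT
          simp only [hI, Finset.mem_inter] at hT
          constructor
          · intro h x hx
            have := h hx
            have := hS hx
            have := hT x
            simp only [Finset.mem_union, Finset.mem_inter] at *
            tauto
          · intro h x hx
            have := h hx
            have := hS hx
            simp only [Finset.mem_union, Finset.mem_inter] at *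
            tauto
        simp only [this, c, hT, if_true]
        split_ifs <;> ring
      · simp [c, hT, Ne.symm hT]
    simp only [h3]
    rw [← Finset.mul_sum, ← hm (T1 ∩ I) Finset.inter_subset_right]
    change _ / H (T1 ∩ I) * H (T1 ∩ I) = _
    by_cases hz : H (T1 ∩ I) = 0
    · have hle : h1 T1 ≤ H (T1 ∩ I) := by
        have := Finset.single_le_sum (f := fun T => if T ∩ I = T1 ∩ I then h1 T else 0)
          (fun T _ => by split_ifs <;> simp [p1]) (Finset.mem_univ T1)
        simpa using this
      have : h1 T1 = 0 := le_antisymm (hz ▸ hle) (p1 _)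
      simp [this]
    · field_simp
  · intro S hS
    rw [Fintype.sum_prod_type_right, e2]
    refine Finset.sum_congr rfl fun T2 _ => ?_
    have h3 : ∀ T1, (if S ⊆ T1 ∩ A ∪ T2 ∩ B then c (T1, T2) else 0)
        = (if S ⊆ T2 then h2 T2 else 0) / H (T2 ∩ I) *
          (if T1 ∩ I = T2 ∩ I then h1 T1 else 0) := by
      intro T1
      by_cases hT : T1 ∩ I = T2 ∩ I
      · have : S ⊆ T1 ∩ A ∪ T2 ∩ B ↔ S ⊆ T2 := by
          rw [Finset.ext_iff] at hT
          simp only [hI, Finset.mem_inter] at hT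
          constructor
          · intro h x hx
            have := h hx
            have := hS hx
            have := hT x
            simp only [Finset.mem_union, Finset.mem_inter] at *
            tauto
          · intro h x hx
            have := h hx
            have := hS hx
            simp only [Finset.mem_union, Finset.mem_inter] at *
            tauto
        simp only [this, c, hT, if_true]
        split_ifs <;> ring
      · simp [c, hT]
    simp only [h3]
    rw [← Finset.mul_sum]
    change _ / H (T2 ∩ I) * H (T2 ∩ I) = _
    by_cases hz : H (T2 ∩ I) = 0
    · have hle : h2 T2 ≤ H (T2 ∩ I) := by
        have := Finset.single_le_sum (f := fun T => if T ∩ I = T2 ∩ I then h2 T else 0)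
          (fun T _ => by split_ifs <;> simp [p2]) (Finset.mem_univ T2)
        rw [hH]
        dsimp only
        rw [hm _ Finset.inter_subset_right]
        simpa using this
      have : h2 T2 = 0 := le_antisymm (hz ▸ hle) (p2 _)
      simp [this]
    · field_simp

/-- Convex hull membership in terms of moments. -/
lemma mem_hull_iff (Vs : Finset V) (E : Finset (Finset V))
    (hE : ∀ e ∈ E, e ⊆ Vs ∧ 2 ≤ e.card) (z : Finset V → ℝ) :
    z ∈ convexHull ℝ (MultilinearSet Vs E) ↔
      ∃ g, IsMom g ∧ g ∅ = 1 ∧ (∀ u ∈ Vs, z {u} = g {u}) ∧ ∀ e ∈ E, z e = g e := by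
  constructor
  · intro hz
    let P : Set (Finset V → ℝ) :=
      {z | ∃ g, IsMom g ∧ g ∅ = 1 ∧ (∀ u ∈ Vs, z {u} = g {u}) ∧ ∀ e ∈ E, z e = g e}
    have hconv : Convex ℝ P := by
      rintro x ⟨g, hg, hg1, hg2, hg3⟩ y ⟨k, hk, hk1, hk2, hk3⟩ a b ha hb hab
      refine ⟨_, hg.comb hk ha hb, ?_, ?_, ?_⟩
      · simp [hg1, hk1, hab]
      · intro u hu
        simp [hg2 u hu, hk2 u hu]
      · intro u hu
        simp [hg3 u hu, hk3 u hu]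
    refine convexHull_min ?_ hconv hz
    rintro y ⟨x, hx, hy1, hy2⟩
    refine ⟨_, IsMom.of_sum (fun _ : Unit => (1 : ℝ)) (fun _ => by norm_num)
      (fun _ => Vs.filter (fun u => x u = 1)), ?_, ?_, ?_⟩
    · simp
    · intro u hu
      rw [hy1 u hu]
      rcases hx u hu with h | h <;> simp [h, hu]
    · intro e he
      rw [hy2 e he]
      simp only [Finset.univ_unique, Finset.sum_singleton]
      split_ifs with h
      · apply Finset.prod_eq_one
        intro u hu
        exact (Finset.mem_filter.1 (h hu)).2
      · obtain ⟨u, hu, hu'⟩ := Finset.not_subset.1 h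
        refine Finset.prod_eq_zero hu ?_
        have huV := (hE e he).1 hu
        rcases hx u huV with h0 | h0
        · exact h0
        · exact absurd (by simp [huV, h0]) hu'
  · rintro ⟨g, ⟨h, hp, hg⟩, hg1, hgu, hge⟩
    let zT : Finset V → Finset V → ℝ := fun T S =>
      if S ∈ E ∨ ∃ u ∈ Vs, S = {u} then (if S ⊆ T then 1 else 0) else z S
    have hsum : ∑ T, h T = 1 := by
      rw [← hg1, hg]
      simp
    have : z = ∑ T, h T • zT T := by
      ext S
      simp only [Finset.sum_apply, Pi.smul_apply, smul_eq_mul, zT]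
      by_cases hS : S ∈ E ∨ ∃ u ∈ Vs, S = {u}
      · simp only [hS, if_true, mul_ite, mul_one, mul_zero]
        rw [← hg]
        rcases hS with hS | ⟨u, hu, rfl⟩
        · exact hge S hS
        · exact hgu u hu
      · simp only [hS, if_false]
        rw [← Finset.sum_mul, hsum, one_mul]
    rw [this]
    refine (convex_convexHull ℝ _).sum_mem (fun T _ => hp T) hsum fun T _ => ?_
    apply subset_convexHull
    refine ⟨fun u => if u ∈ T then 1 else 0, ?_, ?_, ?_⟩
    · intro u _
      by_cases hu : u ∈ T <;> simp [hu]
    · intro u hu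
      have : (({u} : Finset V) ∈ E ∨ ∃ u' ∈ Vs, ({u} : Finset V) = {u'}) := Or.inr ⟨u, hu, rfl⟩
      simp only [zT, this, if_true, Finset.singleton_subset_iff]
    · intro e he
      simp only [zT, he, true_or, if_true]
      split_ifs with hh
      · symm
        apply Finset.prod_eq_one
        intro u hu
        simp [hh hu]
      · obtain ⟨u, hu, hu'⟩ := Finset.not_subset.1 hh
        symm
        exact Finset.prod_eq_zero hu (by simp [hu'])

/-- Triple construction. -/
lemma triple (x y u : V) (hxy : x ≠ y) (hxu : x ≠ u) (hyu : y ≠ u)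
    (w a b c p q r : ℝ)
    (hp0 : 0 ≤ p) (hpa : p ≤ a) (hpb : p ≤ b) (hpw : a + b - p ≤ w)
    (hq0 : 0 ≤ q) (hqb : q ≤ b) (hqc : q ≤ c) (hqw : b + c - q ≤ w)
    (hr0 : 0 ≤ r) (hra : r ≤ a) (hrc : r ≤ c) (hrw : a + c - r ≤ w)
    (t1 : p + q - b ≤ r) (t2 : p + r - a ≤ q) (t3 : q + r - c ≤ p)
    (t4 : a + b + c - p - q - r ≤ w) :
    ∃ g : Finset V → ℝ, IsMom g ∧ g ∅ = w ∧ g {x} = a ∧ g {y} = b ∧ g {u} = c ∧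
      g {x, y} = p ∧ g {y, u} = q ∧ g {x, u} = r := by
  obtain ⟨s, s1, s2, s3, s4, s5, s6, s7, s8⟩ : ∃ s : ℝ, 0 ≤ s ∧ p + r - a ≤ s ∧ p + q - b ≤ s ∧
      q + r - c ≤ s ∧ s ≤ p ∧ s ≤ q ∧ s ≤ r ∧ s ≤ w - a - b - c + p + q + r := by
    refine ⟨max (max 0 (p + r - a)) (max (p + q - b) (q + r - c)), by simp, by simp, by simp,
      by simp, ?_, ?_, ?_, ?_⟩ <;> simp only [max_le_iff] <;>
      refine ⟨⟨?_, ?_⟩, ?_, ?_⟩ <;> linarith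
  refine ⟨_, IsMom.of_sum (![s, p - s, q - s, r - s, a - p - r + s, b - p - q + s, c - q - r + s,
    w - a - b - c + p + q + r - s]) ?_ (![{x, y, u}, {x, y}, {y, u}, {x, u}, {x}, {y}, {u}, ∅]),
    ?_, ?_, ?_, ?_, ?_, ?_, ?_⟩
  · intro i
    fin_cases i <;> simp <;> linarith
  all_goals
    simp [Fin.sum_univ_eight, hxy, hxu, hyu, hxy.symm, hxu.symm, hyu.symm,
      Finset.insert_subset_iff]
  all_goals try ring

end Mom

section Path
variable {V : Type} [Fintype V] [DecidableEq V]

/-- parity-constrained minimal costs (even, odd) -/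
noncomputable def parM (w : ℝ) (t : ℕ → ℝ) : ℕ → ℝ × ℝ
  | 0 => (0, w)
  | k + 1 => (min ((parM w t k).1 + t k) ((parM w t k).2 + (w - t k)),
              min ((parM w t k).2 + t k) ((parM w t k).1 + (w - t k)))

lemma parM_attain (w : ℝ) (t : ℕ → ℝ) (h0 : ∀ i, 0 ≤ t i) (h1 : ∀ i, t i ≤ w) (k : ℕ) :
    (w ≤ (parM w t k).1 ∨ ∃ D ⊆ range k, Even D.card ∧
      (∑ i ∈ range k, if i ∈ D then w - t i else t i) = (parM w t k).1) ∧
    (w ≤ (parM w t k).2 ∨ ∃ D ⊆ range k, Odd D.card ∧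
      (∑ i ∈ range k, if i ∈ D then w - t i else t i) = (parM w t k).2) := by
  induction k with
  | zero =>
    refine ⟨Or.inr ⟨∅, by simp, by simp, by simp [parM]⟩, Or.inl (by simp [parM])⟩
  | succ k ih =>
    have a0 := h0 k
    have a1 := h1 k
    have hno : ∀ (D : Finset ℕ), D ⊆ range k → ∀ x,
        (∑ i ∈ range k, if i ∈ D then w - t i else t i) = x →
        (∑ i ∈ range (k+1), if i ∈ D then w - t i else t i) = x + t k := by
      intro D hD x hx
      have : k ∉ D := fun h => by simpa using hD h
      rw [Finset.sum_range_succ, hx]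
      simp [this]
    have hyes : ∀ (D : Finset ℕ), D ⊆ range k → ∀ x,
        (∑ i ∈ range k, if i ∈ D then w - t i else t i) = x →
        (∑ i ∈ range (k+1), if i ∈ insert k D then w - t i else t i) = x + (w - t k) := by
      intro D hD x hx
      rw [Finset.sum_range_succ, ← hx]
      congr 1
      · refine Finset.sum_congr rfl fun i hi => ?_
        have : i ≠ k := by
          have := Finset.mem_range.1 hi
          omega
        simp [this]
      · simp
    have hcard : ∀ (D : Finset ℕ), D ⊆ range k → (insert k D).card = D.card + 1 := by
      intro D hD
      exact Finset.card_insert_of_notMem fun h => by simpa using hD h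
    have hsub : ∀ (D : Finset ℕ), D ⊆ range k → D ⊆ range (k+1) := fun D hD =>
      hD.trans (Finset.range_subset_range.2 (by omega))
    have hsub' : ∀ (D : Finset ℕ), D ⊆ range k → insert k D ⊆ range (k+1) := fun D hD =>
      Finset.insert_subset (by simp) (hsub D hD)
    obtain ⟨ihe, iho⟩ := ih
    simp only [parM]
    constructor
    · rcases min_choice ((parM w t k).1 + t k) ((parM w t k).2 + (w - t k)) with h | h
      · rw [h]
        rcases ihe with ih | ⟨D, hD, hc, hs⟩
        · left; linarith
        · exact Or.inr ⟨D, hsub D hD, hc, hno D hD _ hs⟩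
      · rw [h]
        rcases iho with ih | ⟨D, hD, hc, hs⟩
        · left; linarith
        · exact Or.inr ⟨_, hsub' D hD, by rw [hcard D hD]; exact hc.add_one, hyes D hD _ hs⟩
    · rcases min_choice ((parM w t k).2 + t k) ((parM w t k).1 + (w - t k)) with h | h
      · rw [h]
        rcases iho with ih | ⟨D, hD, hc, hs⟩
        · left; linarith
        · exact Or.inr ⟨D, hsub D hD, hc, hno D hD _ hs⟩
      · rw [h]
        rcases ihe with ih | ⟨D, hD, hc, hs⟩
        · left; linarith
        · exact Or.inr ⟨_, hsub' D hD, by rw [hcard D hD]; exact hc.add_one, hyes D hD _ hs⟩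

lemma parM_inv (w : ℝ) (t a : ℕ → ℝ) (ha0 : ∀ i, 0 ≤ a i) (haw : ∀ i, a i ≤ w)
    (h1 : ∀ i, a i - a (i+1) ≤ t i) (h2 : ∀ i, a (i+1) - a i ≤ t i)
    (h3 : ∀ i, t i ≤ a i + a (i+1)) (h4 : ∀ i, t i ≤ 2 * w - a i - a (i+1)) (k : ℕ) :
    w ≤ (parM w t k).1 + (parM w t k).2 ∧ a 0 - a k ≤ (parM w t k).1 ∧
    a k - a 0 ≤ (parM w t k).1 ∧ w - a 0 - a k ≤ (parM w t k).2 ∧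
    a 0 + a k - w ≤ (parM w t k).2 := by
  induction k with
  | zero =>
    have := ha0 0
    have := haw 0
    refine ⟨?_, ?_, ?_, ?_, ?_⟩ <;> simp only [parM] <;> linarith
  | succ k ih =>
    obtain ⟨i1, i2, i3, i4, i5⟩ := ih
    have := h1 k
    have := h2 k
    have := h3 k
    have := h4 k
    simp only [parM]
    refine ⟨?_, ?_, ?_, ?_, ?_⟩
    · rcases min_choice ((parM w t k).1 + t k) ((parM w t k).2 + (w - t k)) with h | h <;>
      rcases min_choice ((parM w t k).2 + t k) ((parM w t k).1 + (w - t k)) with h' | h' <;>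
      rw [h, h'] <;> linarith
    all_goals rw [le_min_iff]; constructor <;> linarith

lemma exists_q (w a b c t q' e o : ℝ)
    (m1 : a - b ≤ e) (m2 : b - a ≤ e) (m3 : w - a - b ≤ o) (m4 : a + b - w ≤ o) (m5 : w ≤ e + o)
    (a0 : 0 ≤ a) (b0 : 0 ≤ b) (aw : a ≤ w) (bw : b ≤ w)
    (h1 : b - c ≤ t) (h2 : c - b ≤ t) (h3 : t ≤ b + c) (h4 : t ≤ 2 * w - b - c)
    (k1 : a - c ≤ q') (k2 : c - a ≤ q') (k3 : q' ≤ a + c) (k4 : q' ≤ 2 * w - a - c)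
    (n1 : q' ≤ e + t) (n2 : q' ≤ o + (w - t)) (n3 : w - q' ≤ o + t) (n4 : w - q' ≤ e + (w - t)) :
    ∃ q, w - o ≤ q ∧ a - b ≤ q ∧ b - a ≤ q ∧ t - q' ≤ q ∧ q' - t ≤ q ∧
      q ≤ e ∧ q ≤ a + b ∧ q ≤ 2 * w - a - b ∧ q ≤ t + q' ∧ q ≤ 2 * w - t - q' := by
  refine ⟨max (w - o) (max (max (a - b) (b - a)) (max (t - q') (q' - t))), by simp, by simp,
    by simp, by simp, by simp, ?_, ?_, ?_, ?_, ?_⟩ <;> simp only [max_le_iff] <;>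
    refine ⟨?_, ⟨?_, ?_⟩, ?_, ?_⟩ <;> linarith

lemma mccormick {g : Finset V → ℝ} (hg : IsMom g) (x y : V) :
    0 ≤ g {x, y} ∧ g {x, y} ≤ g {x} ∧ g {x, y} ≤ g {y} ∧ g {x} + g {y} - g {x, y} ≤ g ∅ := by
  obtain ⟨h, hp, e⟩ := hg
  simp only [e]
  refine ⟨?_, ?_, ?_, ?_⟩
  · exact Finset.sum_nonneg fun T _ => by split_ifs <;> simp [hp]
  · refine Finset.sum_le_sum fun T _ => ?_
    have := hp T
    by_cases h1 : x ∈ T <;> by_cases h2 : y ∈ T <;> simp [h1, h2, Finset.insert_subset_iff, this]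
  · refine Finset.sum_le_sum fun T _ => ?_
    have := hp T
    by_cases h1 : x ∈ T <;> by_cases h2 : y ∈ T <;> simp [h1, h2, Finset.insert_subset_iff, this]
  · rw [← Finset.sum_add_distrib, ← Finset.sum_sub_distrib]
    refine Finset.sum_le_sum fun T _ => ?_
    have := hp T
    by_cases h1 : x ∈ T <;> by_cases h2 : y ∈ T <;> simp [h1, h2, Finset.insert_subset_iff, this]

lemma subset_pair {x y : V} {S : Finset V} (h : S ⊆ {x, y}) :
    S = ∅ ∨ S = {x} ∨ S = {y} ∨ S = {x, y} := by
  have := Finset.mem_powerset.2 h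
  by_cases h1 : x ∈ S <;> by_cases h2 : y ∈ S
  · right; right; right
    exact Finset.Subset.antisymm h (by simp [Finset.insert_subset_iff, h1, h2])
  · right; left
    ext a
    have := @h a
    simp only [Finset.mem_insert, Finset.mem_singleton] at *
    constructor
    · intro ha
      rcases this ha with rfl | rfl
      · rfl
      · exact absurd ha h2
    · rintro rfl; exact h1
  · right; right; left
    ext a
    have := @h a
    simp only [Finset.mem_insert, Finset.mem_singleton] at *
    constructor
    · intro ha
      rcases this ha with rfl | rfl
      · exact absurd ha h1
      · rfl
    · rintro rfl; exact h2
  · left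
    ext a
    have := @h a
    simp only [Finset.mem_insert, Finset.mem_singleton] at *
    simp only [Finset.notMem_empty, iff_false]
    intro ha
    rcases this ha with rfl | rfl
    · exact h1 ha
    · exact h2 ha

lemma path_lemma (n : ℕ) (u : ℕ → V) (hu : ∀ i ≤ n, ∀ j ≤ n, u i = u j → i = j)
    (g : Finset V → ℝ)
    (hloc : ∀ i, ∃ k, IsMom k ∧ ∀ S ⊆ ({u i, u (i+1)} : Finset V), k S = g S)
    (t : ℕ → ℝ) (ht : ∀ i, t i = g {u i} + g {u (i+1)} - 2 * g {u i, u (i+1)}) :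
    ∀ k, 1 ≤ k → k ≤ n → ∀ q : ℝ,
      g {u 0} - g {u k} ≤ q → g {u k} - g {u 0} ≤ q → q ≤ g {u 0} + g {u k} →
      q ≤ 2 * g ∅ - g {u 0} - g {u k} →
      g ∅ - q ≤ (parM (g ∅) t k).2 → q ≤ (parM (g ∅) t k).1 →
      ∃ f, IsMom f ∧ (∀ i < k, ∀ S ⊆ ({u i, u (i+1)} : Finset V), f S = g S) ∧
        f {u 0} + f {u k} - 2 * f {u 0, u k} = q := by
  have hmc : ∀ i, 0 ≤ g {u i, u (i+1)} ∧ g {u i, u (i+1)} ≤ g {u i} ∧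
      g {u i, u (i+1)} ≤ g {u (i+1)} ∧ g {u i} + g {u (i+1)} - g {u i, u (i+1)} ≤ g ∅ := by
    intro i
    obtain ⟨k, hk, e⟩ := hloc i
    have := mccormick hk (u i) (u (i+1))
    rwa [e _ le_rfl, e {u i} (by simp), e {u (i+1)} (by simp), e ∅ (by simp)] at this
  have ha0 : ∀ i, 0 ≤ g {u i} := fun i => by have := hmc i; linarith
  have haw : ∀ i, g {u i} ≤ g ∅ := fun i => by have := hmc i; linarith
  have h1 : ∀ i, g {u i} - g {u (i+1)} ≤ t i := fun i => by
    have := hmc i; rw [ht]; linarith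
  have h2 : ∀ i, g {u (i+1)} - g {u i} ≤ t i := fun i => by
    have := hmc i; rw [ht]; linarith
  have h3 : ∀ i, t i ≤ g {u i} + g {u (i+1)} := fun i => by
    have := hmc i; rw [ht]; linarith
  have h4 : ∀ i, t i ≤ 2 * g ∅ - g {u i} - g {u (i+1)} := fun i => by
    have := hmc i; rw [ht]; linarith
  intro k hk
  induction k, hk using Nat.le_induction with
  | base =>
    intro _ q _ _ _ _ hq1 hq2
    simp only [parM] at hq1 hq2
    have e1 := hq1.trans (min_le_right _ _)
    have e2 := hq2.trans (min_le_left _ _)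
    obtain ⟨f, hf, e⟩ := hloc 0
    refine ⟨f, hf, ?_, ?_⟩
    · intro i hi
      obtain rfl : i = 0 := by omega
      exact e
    · have := ht 0
      simp only [zero_add] at *
      rw [e _ le_rfl, e {u 0} (by simp), e {u 1} (by simp)]
      linarith
  | succ k hk ih =>
    intro hkn q' k1 k2 k3 k4 n1 n2
    obtain ⟨m5, m1, m2, m3, m4⟩ := parM_inv (g ∅) t (fun i => g {u i}) ha0 haw h1 h2 h3 h4 k
    simp only [parM, le_min_iff] at n1 n2
    obtain ⟨q, q1, q2, q3, q4, q5, q6, q7, q8, q9, q10⟩ :=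
      exists_q (g ∅) (g {u 0}) (g {u k}) (g {u (k+1)}) (t k) q' _ _ m1 m2 m3 m4 m5
        (ha0 0) (ha0 k) (haw 0) (haw k) (h1 k) (h2 k) (h3 k) (h4 k) k1 k2 k3 k4
        n2.1 n2.2 n1.1 n1.2
    obtain ⟨f, hf, hfe, hfq⟩ := ih (by omega) q q2 q3 q7 q8 (by linarith) q6
    have d1 : u 0 ≠ u k := fun h => by
      have := hu 0 (by omega) k (by omega) h
      omega
    have d2 : u 0 ≠ u (k+1) := fun h => by
      have := hu 0 (by omega) (k+1) (by omega) h
      omega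
    have d3 : u k ≠ u (k+1) := fun h => by
      have := hu k (by omega) (k+1) (by omega) h
      omega
    have htk := ht k
    obtain ⟨m1', m2', m3', m4'⟩ := hmc k
    have f0 : f ∅ = g ∅ := hfe 0 (by omega) _ (by simp)
    have f1 : f {u 0} = g {u 0} := hfe 0 (by omega) _ (by simp)
    have f2 : f {u k} = g {u k} := by
      obtain ⟨j, rfl⟩ : ∃ j, k = j + 1 := ⟨k - 1, by omega⟩
      exact hfe j (by omega) _ (by simp)
    rw [f1, f2] at hfq
    obtain ⟨τ, hτ, τ0, τ1, τ2, τ3, τ4, τ5, τ6⟩ := triple (u 0) (u k) (u (k+1)) d1 d2 d3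
      (g ∅) (g {u 0}) (g {u k}) (g {u (k+1)}) (f {u 0, u k}) (g {u k, u (k+1)})
      ((g {u 0} + g {u (k+1)} - q') / 2)
      (by linarith) (by linarith) (by linarith) (by linarith)
      (by linarith) (by linarith) (by linarith) (by linarith)
      (by linarith) (by linarith) (by linarith) (by linarith)
      (by linarith) (by linarith) (by linarith) (by linarith)
    have hinter : (range (k+1)).image u ∩ {u 0, u k, u (k+1)} ⊆ {u 0, u k} := by
      intro x hx
      simp only [Finset.mem_inter, Finset.mem_image, Finset.mem_range, Finset.mem_insert,
        Finset.mem_singleton] at hx ⊢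
      obtain ⟨⟨j, hj, rfl⟩, h | h | h⟩ := hx
      · exact Or.inl h
      · exact Or.inr h
      · have := hu j (by omega) (k+1) (by omega) h
        omega
    obtain ⟨F, hF, F1, F2⟩ := glue hf hτ ((range (k+1)).image u) {u 0, u k, u (k+1)} (by
      intro S hS
      rcases subset_pair (hS.trans hinter) with rfl | rfl | rfl | rfl
      · rw [f0, τ0]
      · rw [f1, τ1]
      · rw [f2, τ2]
      · rw [τ4])
    refine ⟨F, hF, ?_, ?_⟩
    · intro i hi S hS
      rcases Nat.lt_succ_iff_lt_or_eq.1 hi with hi | rfl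
      · rw [F1, hfe i hi S hS]
        refine hS.trans ?_
        intro x hx
        simp only [Finset.mem_insert, Finset.mem_singleton, Finset.mem_image,
          Finset.mem_range] at hx ⊢
        rcases hx with rfl | rfl
        · exact ⟨i, by omega, rfl⟩
        · exact ⟨i+1, by omega, rfl⟩
      · rw [F2 S (hS.trans (by simp))]
        rcases subset_pair hS with rfl | rfl | rfl | rfl
        · exact τ0
        · exact τ2
        · exact τ3
        · exact τ5
    · rw [F2 {u 0} (by simp), F2 {u (k+1)} (by simp), F2 {u 0, u (k+1)} (by
        simp [Finset.insert_subset_iff]), τ1, τ3, τ6]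
      ring

lemma sum_range_zmod (m : ℕ) [NeZero m] (f : ZMod m → ℝ) :
    ∑ i ∈ range m, f (i : ZMod m) = ∑ i, f i := by
  refine Finset.sum_bij' (fun i _ => (i : ZMod m)) (fun j _ => j.val) ?_ ?_ ?_ ?_ ?_
  · simp
  · intro j _
    simpa using ZMod.val_lt j
  · intro i hi
    exact ZMod.val_cast_of_lt (Finset.mem_range.1 hi)
  · simp
  · simp

lemma cycle_lemma (m : ℕ) [NeZero m] (hm : 3 ≤ m) (v : ZMod m → V) (hv : Function.Injective v)
    (g : Finset V → ℝ)
    (hloc : ∀ i, ∃ k, IsMom k ∧ ∀ S ⊆ ({v i, v (i+1)} : Finset V), k S = g S)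
    (hodd : ∀ D : Finset (ZMod m), Odd D.card → g ∅ ≤ ∑ i, if i ∈ D
      then g ∅ - (g {v i} + g {v (i+1)} - 2 * g {v i, v (i+1)})
      else g {v i} + g {v (i+1)} - 2 * g {v i, v (i+1)}) :
    ∃ f, IsMom f ∧ ∀ i, ∀ S ⊆ ({v i, v (i+1)} : Finset V), f S = g S := by
  let t' : ZMod m → ℝ := fun i => g {v i} + g {v (i+1)} - 2 * g {v i, v (i+1)}
  let t : ℕ → ℝ := fun i => t' (i : ZMod m)
  have hmc : ∀ i, 0 ≤ g {v i, v (i+1)} ∧ g {v i, v (i+1)} ≤ g {v i} ∧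
      g {v i, v (i+1)} ≤ g {v (i+1)} ∧ g {v i} + g {v (i+1)} - g {v i, v (i+1)} ≤ g ∅ := by
    intro i
    obtain ⟨k, hk, e⟩ := hloc i
    have := mccormick hk (v i) (v (i+1))
    rwa [e _ le_rfl, e {v i} (by simp), e {v (i+1)} (by simp), e ∅ (by simp)] at this
  have ht0 : ∀ i, 0 ≤ t i := fun i => by
    have := hmc i; simp only [t, t']; linarith
  have ht1 : ∀ i, t i ≤ g ∅ := fun i => by
    have := hmc i; simp only [t, t']; linarith
  have hM : g ∅ ≤ (parM (g ∅) t m).2 := by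
    rcases (parM_attain (g ∅) t ht0 ht1 m).2 with h | ⟨D, hD, hc, hs⟩
    · exact h
    · have hD' : Odd (univ.filter (fun i : ZMod m => i.val ∈ D)).card := by
        convert hc using 1
        refine Finset.card_bij' (fun i _ => i.val) (fun j _ => (j : ZMod m)) ?_ ?_ ?_ ?_
        · simp
        · intro j hj
          have := Finset.mem_range.1 (hD hj)
          simpa [ZMod.val_cast_of_lt this] using hj
        · simp
        · intro j hj
          exact ZMod.val_cast_of_lt (Finset.mem_range.1 (hD hj))
      refine (hodd _ hD').trans ?_
      rw [← hs, ← sum_range_zmod]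
      refine le_of_eq (Finset.sum_congr rfl fun i hi => ?_)
      have : ((i : ZMod m)).val = i := ZMod.val_cast_of_lt (Finset.mem_range.1 hi)
      simp [this, t, t']
  obtain ⟨n, rfl⟩ : ∃ n, m = n + 1 := ⟨m - 1, by omega⟩
  simp only [parM, le_min_iff] at hM
  have hn0 : ((n : ℕ) : ZMod (n+1)) + 1 = 0 := by
    have := ZMod.natCast_self (n+1)
    push_cast at this
    exact this
  have hmn := hmc (n : ZMod (n+1))
  have htn : t n = g {v n} + g {v 0} - 2 * g {v n, v 0} := by
    simp only [t, t', hn0]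
  rw [hn0] at hmn
  obtain ⟨f, hf, hfe, hfq⟩ := path_lemma n (fun i => v (i : ZMod (n+1))) (by
      intro i hi j hj hij
      have h1 := congrArg ZMod.val (hv hij)
      rwa [ZMod.val_cast_of_lt (by omega), ZMod.val_cast_of_lt (by omega)] at h1) g
    (fun i => by
      have := hloc i
      simpa using this) t (fun i => by simp [t, t']) n (by omega) le_rfl (t n)
    (by simp only [Nat.cast_zero]; linarith)
    (by simp only [Nat.cast_zero]; linarith)
    (by simp only [Nat.cast_zero]; linarith)
    (by simp only [Nat.cast_zero]; linarith)
    (by linarith) (by linarith)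
  refine ⟨f, hf, ?_⟩
  intro i S hS
  have hi := ZMod.natCast_zmod_val i
  have hlt := ZMod.val_lt i
  by_cases hin : i.val < n
  · refine hfe i.val hin S ?_
    push_cast
    rwa [hi]
  · have hin' : i.val = n := by omega
    have : i = (n : ZMod (n+1)) := by rw [← hi, hin']
    subst this
    rw [hn0] at hS
    have f0 : f ∅ = g ∅ := hfe 0 (by omega) _ (by simp)
    have f1 : f {v 0} = g {v 0} := hfe 0 (by omega) _ (by simp)
    have f2 : f {v n} = g {v n} := by
      have := hfe (n-1) (by omega) {v n} (by
        rw [show n - 1 + 1 = n by omega]; simp)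
      exact this
    simp only [Nat.cast_zero] at hfq
    rcases subset_pair hS with rfl | rfl | rfl | rfl
    · exact f0
    · exact f2
    · exact f1
    · rw [Finset.pair_comm (v 0)] at hfq
      linarith

/-- Validity of odd cycle inequalities. -/
lemma odd_valid (m : ℕ) [NeZero m] (v : ZMod m → V)
    {g : Finset V → ℝ} (hg : IsMom g) (D : Finset (ZMod m)) (hD : Odd D.card) :
    g ∅ ≤ ∑ i, if i ∈ D
      then g ∅ - (g {v i} + g {v (i+1)} - 2 * g {v i, v (i+1)})
      else g {v i} + g {v (i+1)} - 2 * g {v i, v (i+1)} := by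
  obtain ⟨h, hp, e⟩ := hg
  let dl : Finset V → Finset V → ℝ := fun S T => if S ⊆ T then 1 else 0
  have e' : ∀ S, g S = ∑ T, h T * dl S T := by
    intro S
    rw [e]
    refine Finset.sum_congr rfl fun T _ => ?_
    simp [dl]
  have : ∀ i, (if i ∈ D
      then g ∅ - (g {v i} + g {v (i+1)} - 2 * g {v i, v (i+1)})
      else g {v i} + g {v (i+1)} - 2 * g {v i, v (i+1)}) =
      ∑ T, h T * (if i ∈ D
      then dl ∅ T - (dl {v i} T + dl {v (i+1)} T - 2 * dl {v i, v (i+1)} T)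
      else dl {v i} T + dl {v (i+1)} T - 2 * dl {v i, v (i+1)} T) := by
    intro i
    simp only [e']
    split_ifs
    · rw [Finset.mul_sum, ← Finset.sum_add_distrib, ← Finset.sum_sub_distrib,
        ← Finset.sum_sub_distrib]
      refine Finset.sum_congr rfl fun T _ => by ring
    · rw [Finset.mul_sum, ← Finset.sum_add_distrib, ← Finset.sum_sub_distrib]
      refine Finset.sum_congr rfl fun T _ => by ring
  simp only [this]
  rw [Finset.sum_comm, e' ∅]
  refine Finset.sum_le_sum fun T _ => ?_
  rw [← Finset.mul_sum]
  refine mul_le_mul_of_nonneg_left ?_ (hp T)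
  let s : ZMod m → ℝ := fun i => if v i ∈ T then 1 else 0
  have hs : ∀ i, s i = 0 ∨ s i = 1 := fun i => by
    by_cases h : v i ∈ T <;> simp [s, h]
  have h0 : dl ∅ T = 1 := by simp [dl]
  have h1 : ∀ i, dl {v i} T = s i := by simp [dl, s]
  have h2 : ∀ i, dl {v i, v (i+1)} T = s i * s (i+1) := by
    intro i
    by_cases a : v i ∈ T <;> by_cases b : v (i+1) ∈ T <;>
      simp [dl, s, a, b, Finset.insert_subset_iff]
  simp only [h0, h1, h2]
  by_contra hlt
  push Not at hlt
  have hnn : ∀ i, 0 ≤ (if i ∈ D then 1 - (s i + s (i+1) - 2 * (s i * s (i+1)))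
      else s i + s (i+1) - 2 * (s i * s (i+1))) := by
    intro i
    rcases hs i with a | a <;> rcases hs (i+1) with b | b <;> rw [a, b] <;> split_ifs <;> norm_num
  have hz : ∀ i, (1 - 2 * s i) * (1 - 2 * s (i+1)) = if i ∈ D then -1 else 1 := by
    intro i
    have hle := (Finset.single_le_sum (fun j _ => hnn j) (Finset.mem_univ i)).trans_lt hlt
    revert hle
    rcases hs i with a | a <;> rcases hs (i+1) with b | b <;> rw [a, b] <;> split_ifs <;> norm_num
  have hprod : ∏ i, ((1 - 2 * s i) * (1 - 2 * s (i+1))) = ∏ i, if i ∈ D then (-1 : ℝ) else 1 :=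
    Finset.prod_congr rfl fun i _ => hz i
  have hsh : ∏ i, (1 - 2 * s (i+1)) = ∏ i, (1 - 2 * s i) :=
    Equiv.prod_comp (Equiv.addRight (1 : ZMod m)) (fun i => 1 - 2 * s i)
  rw [Finset.prod_mul_distrib, Finset.prod_ite_mem, Finset.univ_inter, Finset.prod_const,
    hD.neg_one_pow, hsh] at hprod
  nlinarith [mul_self_nonneg (∏ i, (1 - 2 * s i))]

end Path

section Bridge
variable {V : Type} [DecidableEq V]

lemma edge_inj (m : ℕ) [NeZero m] (hm : 3 ≤ m) (v : ZMod m → V) (hv : Function.Injective v) :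
    Function.Injective (fun i : ZMod m => ({v i, v (i + 1)} : Finset V)) := by
  intro i j hij
  have h1 : v i ∈ ({v j, v (j+1)} : Finset V) := by
    have : v i ∈ ({v i, v (i+1)} : Finset V) := by simp
    simpa only [hij] using (show v i ∈ (fun i : ZMod m => ({v i, v (i + 1)} : Finset V)) j from
      hij ▸ this)
  have h2 : v (i+1) ∈ ({v j, v (j+1)} : Finset V) := by
    have : v (i+1) ∈ ({v i, v (i+1)} : Finset V) := by simp
    simpa only [hij] using (show v (i+1) ∈ (fun i : ZMod m => ({v i, v (i + 1)} : Finset V)) j from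
      hij ▸ this)
  simp only [Finset.mem_insert, Finset.mem_singleton, hv.eq_iff] at h1 h2
  rcases h1 with h | h
  · exact h
  · rcases h2 with h' | h'
    · exfalso
      rw [h] at h'
      have h3 : ((2 : ℕ) : ZMod m) = 0 := by
        have : j + ((2 : ℕ) : ZMod m) = j + 0 := by
          push_cast
          rw [add_zero]
          calc j + 2 = j + 1 + 1 := by ring
            _ = j := h'
        exact add_left_cancel this
      rw [ZMod.natCast_eq_zero_iff] at h3
      have := Nat.le_of_dvd (by norm_num) h3
      omega
    · exact add_right_cancel h'

lemma filter_edge_card (m : ℕ) [NeZero m] (hm : 3 ≤ m) (v : ZMod m → V)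
    (hv : Function.Injective v) (D : Finset (Finset V))
    (hD : D ⊆ Finset.univ.image fun i : ZMod m => ({v i, v (i + 1)} : Finset V)) :
    (univ.filter (fun i : ZMod m => ({v i, v (i + 1)} : Finset V) ∈ D)).card = D.card := by
  have hinj := edge_inj m hm v hv
  rw [← Finset.card_image_of_injective _ hinj]
  congr 1
  ext e
  simp only [Finset.mem_image, Finset.mem_filter, Finset.mem_univ, true_and]
  constructor
  · rintro ⟨i, hi, rfl⟩
    exact hi
  · intro he
    obtain ⟨i, _, rfl⟩ := Finset.mem_image.1 (hD he)
    exact ⟨i, he, rfl⟩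

lemma bridge (m : ℕ) [NeZero m] (hm : 3 ≤ m) (v : ZMod m → V) (hv : Function.Injective v)
    (D : Finset (Finset V))
    (hD : D ⊆ Finset.univ.image fun i : ZMod m => ({v i, v (i + 1)} : Finset V))
    (hodd : Odd D.card) (α : V → ℝ) (β : Finset V → ℝ) (w : ℝ) :
    ((∑ u ∈ D.biUnion id \ ((Finset.univ.image fun i : ZMod m => ({v i, v (i + 1)} : Finset V))
        \ D).biUnion id, α u)
      - (∑ u ∈ Finset.univ.image v \ D.biUnion id, α u)
      - (∑ e ∈ D, β e)
      + (∑ e ∈ (Finset.univ.image fun i : ZMod m => ({v i, v (i + 1)} : Finset V)) \ D, β e)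
      ≤ ((D.card / 2 : ℕ) : ℝ) * w) ↔
    w ≤ ∑ i, if i ∈ univ.filter (fun i : ZMod m => ({v i, v (i + 1)} : Finset V) ∈ D)
      then w - (α (v i) + α (v (i+1)) - 2 * β {v i, v (i+1)})
      else α (v i) + α (v (i+1)) - 2 * β {v i, v (i+1)} := by
  have hinj := edge_inj m hm v hv
  set ed : ZMod m → Finset V := fun i => ({v i, v (i + 1)} : Finset V) with hed
  set D' : Finset (ZMod m) := univ.filter (fun i : ZMod m => ed i ∈ D) with hD'
  have hmem : ∀ i, i ∈ D' ↔ ed i ∈ D := by simp [hD']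
  have hDim : D = D'.image ed := by
    ext e
    simp only [Finset.mem_image, hmem]
    constructor
    · intro he
      obtain ⟨i, _, rfl⟩ := Finset.mem_image.1 (hD he)
      exact ⟨i, he, rfl⟩
    · rintro ⟨i, hi, rfl⟩
      exact hi
  have hKD : univ.image ed \ D = D'ᶜ.image ed := by
    ext e
    simp only [Finset.mem_sdiff, Finset.mem_image, Finset.mem_compl, hmem]
    constructor
    · rintro ⟨⟨i, _, rfl⟩, h⟩
      exact ⟨i, h, rfl⟩
    · rintro ⟨i, hi, rfl⟩
      exact ⟨⟨i, by simp, rfl⟩, hi⟩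
  have hcard : D.card = D'.card := by
    rw [hDim, Finset.card_image_of_injective _ hinj]
  have hbi : ∀ (X : Finset (ZMod m)) (i : ZMod m),
      v i ∈ (X.image ed).biUnion id ↔ i ∈ X ∨ i - 1 ∈ X := by
    intro X i
    simp only [Finset.mem_biUnion, Finset.mem_image, id]
    constructor
    · rintro ⟨_, ⟨j, hj, rfl⟩, h⟩
      simp only [hed, Finset.mem_insert, Finset.mem_singleton, hv.eq_iff] at h
      rcases h with rfl | rfl
      · exact Or.inl hj
      · right; simpa using hj
    · rintro (h | h)
      · exact ⟨_, ⟨i, h, rfl⟩, by simp [hed]⟩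
      · exact ⟨_, ⟨i - 1, h, rfl⟩, by simp [hed]⟩
  have hrange : ∀ (X : Finset (ZMod m)), ∀ u ∈ (X.image ed).biUnion id, ∃ i, v i = u := by
    intro X u
    simp only [Finset.mem_biUnion, Finset.mem_image, id]
    rintro ⟨_, ⟨j, hj, rfl⟩, h⟩
    simp only [hed, Finset.mem_insert, Finset.mem_singleton] at h
    rcases h with rfl | rfl
    · exact ⟨_, rfl⟩
    · exact ⟨_, rfl⟩
  have hV1 : D.biUnion id \ (univ.image ed \ D).biUnion id
      = (univ.filter (fun i => i ∈ D' ∧ i - 1 ∈ D')).image v := by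
    rw [hKD, hDim]
    ext u
    constructor
    · intro hu
      obtain ⟨i, rfl⟩ := hrange _ _ (Finset.mem_sdiff.1 hu).1
      rw [Finset.mem_sdiff, hbi, hbi, Finset.mem_compl, Finset.mem_compl] at hu
      refine Finset.mem_image_of_mem v ?_
      simp only [Finset.mem_filter, Finset.mem_univ, true_and]
      tauto
    · intro hu
      obtain ⟨i, hi, rfl⟩ := Finset.mem_image.1 hu
      simp only [Finset.mem_filter, Finset.mem_univ, true_and] at hi
      rw [Finset.mem_sdiff, hbi, hbi, Finset.mem_compl, Finset.mem_compl]
      tauto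
  have hV2 : univ.image v \ D.biUnion id
      = (univ.filter (fun i => i ∉ D' ∧ i - 1 ∉ D')).image v := by
    rw [hDim]
    ext u
    constructor
    · intro hu
      obtain ⟨i, _, rfl⟩ := Finset.mem_image.1 (Finset.mem_sdiff.1 hu).1
      rw [Finset.mem_sdiff, hbi] at hu
      refine Finset.mem_image_of_mem v ?_
      simp only [Finset.mem_filter, Finset.mem_univ, true_and]
      tauto
    · intro hu
      obtain ⟨i, hi, rfl⟩ := Finset.mem_image.1 hu
      simp only [Finset.mem_filter, Finset.mem_univ, true_and] at hi
      rw [Finset.mem_sdiff, hbi]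
      have : v i ∈ univ.image v := by simp
      tauto
  rw [hV1, hV2, hKD]
  conv_lhs => rw [hcard]
  have hDs : ∑ e ∈ D, β e = ∑ i, if i ∈ D' then β (ed i) else 0 := by
    rw [hDim, Finset.sum_image (fun a _ b _ h => hinj h)]
    simp
  have hDcs : ∑ e ∈ D'ᶜ.image ed, β e = ∑ i, if i ∈ D' then 0 else β (ed i) := by
    rw [Finset.sum_image (fun a _ b _ h => hinj h)]
    have : ∀ i, (if i ∈ D' then 0 else β (ed i)) = if i ∈ D'ᶜ then β (ed i) else 0 := by
      intro i
      by_cases h : i ∈ D' <;> simp [h]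
    simp only [this, Finset.sum_ite_mem, Finset.univ_inter]
  rw [hDs, hDcs, Finset.sum_image (fun a _ b _ h => hv h),
    Finset.sum_image (fun a _ b _ h => hv h), Finset.sum_filter, Finset.sum_filter]
  obtain ⟨n, hn⟩ := hodd
  rw [hcard] at hn
  have hhalf : ((D'.card / 2 : ℕ) : ℝ) = ((D'.card : ℝ) - 1) / 2 := by
    rw [show D'.card / 2 = n by omega, hn]
    push_cast
    ring
  rw [hhalf]
  have hcs : (D'.card : ℝ) = ∑ i, if i ∈ D' then (1 : ℝ) else 0 := by simp
  have hshift : ∑ i, (if i ∈ D' then (1 : ℝ) else -1) * α (v (i+1))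
      = ∑ i, (if i - 1 ∈ D' then (1 : ℝ) else -1) * α (v i) := by
    rw [← Equiv.sum_comp (Equiv.addRight (1 : ZMod m))
      (fun i => (if i - 1 ∈ D' then (1 : ℝ) else -1) * α (v i))]
    simp
  have e1 : (∑ i, if i ∈ D' then w - (α (v i) + α (v (i+1)) - 2 * β (ed i))
      else α (v i) + α (v (i+1)) - 2 * β (ed i)) =
      (∑ i, if i ∈ D' then (1 : ℝ) else 0) * w
      - ∑ i, (if i ∈ D' then (1 : ℝ) else -1) * α (v i)
      - ∑ i, (if i ∈ D' then (1 : ℝ) else -1) * α (v (i+1))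
      + 2 * (∑ i, if i ∈ D' then β (ed i) else 0)
      - 2 * (∑ i, if i ∈ D' then 0 else β (ed i)) := by
    rw [Finset.sum_mul, Finset.mul_sum, Finset.mul_sum, ← Finset.sum_sub_distrib,
      ← Finset.sum_sub_distrib, ← Finset.sum_add_distrib, ← Finset.sum_sub_distrib]
    refine Finset.sum_congr rfl fun i _ => ?_
    split_ifs <;> ring
  have e2 : 2 * (∑ i, if i ∈ D' ∧ i - 1 ∈ D' then α (v i) else 0)
      - 2 * (∑ i, if i ∉ D' ∧ i - 1 ∉ D' then α (v i) else 0) =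
      ∑ i, (if i ∈ D' then (1 : ℝ) else -1) * α (v i)
      + ∑ i, (if i - 1 ∈ D' then (1 : ℝ) else -1) * α (v i) := by
    rw [Finset.mul_sum, Finset.mul_sum, ← Finset.sum_sub_distrib, ← Finset.sum_add_distrib]
    refine Finset.sum_congr rfl fun i _ => ?_
    by_cases a : i ∈ D' <;> by_cases b : i - 1 ∈ D' <;> simp [a, b] <;> ring
  change _ ↔ w ≤ ∑ i, if i ∈ D' then w - (α (v i) + α (v (i+1)) - 2 * β (ed i))
      else α (v i) + α (v (i+1)) - 2 * β (ed i)
  rw [e1, hshift, ← hcs]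
  constructor <;> intro h <;> linarith

end Bridge

/-- the multilinear polytope of a lifted cycle of cliques is described by the
multilinear polytopes of the individual complete hypergraphs `G_{C_i}` together with the
lifted odd-cycle inequalities. -/
theorem multilinear_polytope_lifted_cycle_of_cliques {V : Type} [Fintype V] [DecidableEq V]
    (m : ℕ) [NeZero m] (hm : 3 ≤ m)
    (C : ZMod m → Finset V) (vbar : V) (v : ZMod m → V)
    (hcard : ∀ i, 3 ≤ (C i).card)
    (hvinj : Function.Injective v)
    (hvbar : ∀ i, v i ≠ vbar)
    (hconsec : ∀ i : ZMod m, C i ∩ C (i + 1) = {v i, vbar})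
    (hnonconsec : ∀ i j : ZMod m, i ≠ j → j ≠ i + 1 → i ≠ j + 1 → C i ∩ C j = {vbar}) :
    convexHull ℝ (MultilinearSet (Finset.univ.biUnion C)
        (Finset.univ.biUnion fun i => (C i).powerset.filter fun e => 2 ≤ e.card)) =
      {z : Finset V → ℝ |
        (∀ i : ZMod m,
          z ∈ convexHull ℝ (MultilinearSet (C i) ((C i).powerset.filter fun e => 2 ≤ e.card))) ∧
        ∀ D ⊆ Finset.univ.image fun i : ZMod m => ({v i, v (i + 1)} : Finset V),
          Odd D.card →
          (letI K : Finset (Finset V) :=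
              Finset.univ.image fun i : ZMod m => ({v i, v (i + 1)} : Finset V)
           letI V1 : Finset V := D.biUnion id \ (K \ D).biUnion id
           letI V2 : Finset V := Finset.univ.image v \ D.biUnion id
           ((∑ u ∈ V1, z {u, vbar}) - (∑ u ∈ V2, z {u, vbar}) -
              (∑ e ∈ D, z (insert vbar e)) + (∑ e ∈ K \ D, z (insert vbar e)) ≤
                ((D.card / 2 : ℕ) : ℝ) * z {vbar}) ∧
            (∑ u ∈ V1, (z {u} - z {u, vbar})) - (∑ u ∈ V2, (z {u} - z {u, vbar})) -
              (∑ e ∈ D, (z e - z (insert vbar e))) + (∑ e ∈ K \ D, (z e - z (insert vbar e))) ≤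
                ((D.card / 2 : ℕ) : ℝ) * (1 - z {vbar}))} := by
  -- basic incidences
  have hvC : ∀ i, v i ∈ C i ∧ v i ∈ C (i+1) := fun i => by
    have : v i ∈ C i ∩ C (i+1) := by rw [hconsec]; simp
    simpa using this
  have hbC : ∀ i, vbar ∈ C i := fun i => by
    have : vbar ∈ C i ∩ C (i+1) := by rw [hconsec]; simp
    exact (Finset.mem_inter.1 this).1
  have hedC : ∀ i, insert vbar ({v i, v (i+1)} : Finset V) ⊆ C (i+1) := by
    intro i
    simp only [Finset.insert_subset_iff, Finset.singleton_subset_iff]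
    exact ⟨hbC _, (hvC i).2, (hvC (i+1)).1⟩
  have hCC : ∀ i j, j ≠ i + 1 → C j ∩ C (i+1) ⊆ insert vbar ({v i, v (i+1)} : Finset V) := by
    intro i j hj
    by_cases h1 : j = i
    · subst h1
      rw [hconsec]
      intro x
      simp only [Finset.mem_insert, Finset.mem_singleton]
      tauto
    · by_cases h2 : j = i + 1 + 1
      · subst h2
        rw [Finset.inter_comm, hconsec]
        intro x
        simp only [Finset.mem_insert, Finset.mem_singleton]
        tauto
      · rw [hnonconsec j (i+1) hj (fun h => h1 (add_right_cancel h).symm) h2]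
        simp
  have hE1 : ∀ i, ∀ e ∈ (C i).powerset.filter (fun e => 2 ≤ e.card), e ⊆ C i ∧ 2 ≤ e.card := by
    intro i e he
    simpa using he
  have hE : ∀ e ∈ (Finset.univ.biUnion fun i => (C i).powerset.filter fun e => 2 ≤ e.card),
      e ⊆ Finset.univ.biUnion C ∧ 2 ≤ e.card := by
    intro e he
    obtain ⟨i, _, hi⟩ := Finset.mem_biUnion.1 he
    obtain ⟨h1, h2⟩ := hE1 i e hi
    exact ⟨h1.trans (Finset.subset_biUnion_of_mem C (Finset.mem_univ i)), h2⟩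
  -- the local description of hull membership
  have hall : ∀ (i : ZMod m) (z g : Finset V → ℝ), (∀ u ∈ C i, z {u} = g {u}) →
      (∀ e ∈ (C i).powerset.filter (fun e => 2 ≤ e.card), z e = g e) →
      ∀ S ⊆ C i, S.Nonempty → z S = g S := by
    intro i z g h1 h2 S hS hne
    by_cases hc : 2 ≤ S.card
    · exact h2 S (by simp [hS, hc])
    · have : S.card = 1 := by
        have := hne.card_pos
        omega
      obtain ⟨u, rfl⟩ := Finset.card_eq_one.1 this
      exact h1 u (by simpa using hS)
  ext z
  rw [mem_hull_iff _ _ hE]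
  simp only [Set.mem_ofPred_eq]
  have hed_ne : ∀ i, ({v i, v (i+1)} : Finset V).Nonempty := fun i => ⟨v i, by simp⟩
  constructor
  · rintro ⟨g, hg, hg1, hgu, hge⟩
    have hloc : ∀ i, (∀ u ∈ C i, z {u} = g {u}) ∧
        (∀ e ∈ (C i).powerset.filter (fun e => 2 ≤ e.card), z e = g e) := by
      intro i
      exact ⟨fun u hu => hgu u (Finset.mem_biUnion.2 ⟨i, by simp, hu⟩),
        fun e he => hge e (Finset.mem_biUnion.2 ⟨i, by simp, he⟩)⟩
    have hz : ∀ i, ∀ S ⊆ C i, S.Nonempty → z S = g S := fun i =>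
      hall i z g (hloc i).1 (hloc i).2
    refine ⟨fun i => ?_, ?_⟩
    · rw [mem_hull_iff _ _ (hE1 i)]
      exact ⟨g, hg, hg1, (hloc i).1, (hloc i).2⟩
    · intro D hD hodd
      have hzb : z {vbar} = g {vbar} := hz 0 _ (by simpa using hbC 0) (by simp)
      have z1 : ∀ i, z {v i} = g {v i} := fun i => hz i _ (by simpa using (hvC i).1) (by simp)
      have z2 : ∀ i, z {v i, vbar} = g {vbar, v i} := fun i => by
        rw [Finset.pair_comm]
        exact hz i _ (by simp [Finset.insert_subset_iff, hbC, (hvC i).1]) (by simp)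
      have z3 : ∀ i, z {v i, v (i+1)} = g {v i, v (i+1)} := fun i =>
        hz (i+1) _ ((Finset.subset_insert _ _).trans (hedC i)) (by simp)
      have z4 : ∀ i, z {vbar, v i, v (i+1)} = g {vbar, v i, v (i+1)} := fun i =>
        hz (i+1) _ (hedC i) (by simp)
      constructor
      · refine (bridge m hm v hvinj D hD hodd (fun u => z {u, vbar})
          (fun e => z (insert vbar e)) (z {vbar})).2 ?_
        have := odd_valid m v (hg.ins vbar) (univ.filter (fun i : ZMod m =>
          ({v i, v (i + 1)} : Finset V) ∈ D)) (by
          rw [filter_edge_card m hm v hvinj D hD]; exact hodd)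
        simpa only [hzb, z2, z4, insert_empty_eq] using this
      · refine (bridge m hm v hvinj D hD hodd (fun u => z {u} - z {u, vbar})
          (fun e => z e - z (insert vbar e)) (1 - z {vbar})).2 ?_
        have := odd_valid m v (hg.del vbar) (univ.filter (fun i : ZMod m =>
          ({v i, v (i + 1)} : Finset V) ∈ D)) (by
          rw [filter_edge_card m hm v hvinj D hD]; exact hodd)
        simpa only [hzb, z1, z2, z3, z4, hg1, insert_empty_eq] using this
  · rintro ⟨hmem, hineq⟩
    have hloc : ∀ i, ∃ g, IsMom g ∧ g ∅ = 1 ∧ ∀ S ⊆ C i, S.Nonempty → z S = g S := by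
      intro i
      obtain ⟨g, hg, hg1, h1, h2⟩ := (mem_hull_iff _ _ (hE1 i) z).1 (hmem i)
      exact ⟨g, hg, hg1, hall i z g h1 h2⟩
    let Z : Finset V → ℝ := fun S => if S = ∅ then 1 else z S
    have hZ0 : Z ∅ = 1 := by simp [Z]
    have hZ : ∀ S : Finset V, S.Nonempty → Z S = z S := fun S hS => by simp [Z, hS.ne_empty]
    have hlocZ : ∀ i, ∃ g, IsMom g ∧ ∀ S ⊆ C i, g S = Z S := by
      intro i
      obtain ⟨g, hg, hg1, h⟩ := hloc i
      refine ⟨g, hg, fun S hS => ?_⟩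
      rcases S.eq_empty_or_nonempty with rfl | hne
      · rw [hg1, hZ0]
      · rw [hZ S hne, h S hS hne]
    have hDexists : ∀ D' : Finset (ZMod m), ∃ D ⊆ Finset.univ.image fun i : ZMod m =>
        ({v i, v (i + 1)} : Finset V), D.card = D'.card ∧
        univ.filter (fun i : ZMod m => ({v i, v (i + 1)} : Finset V) ∈ D) = D' := by
      intro D'
      have hinj := edge_inj m hm v hvinj
      refine ⟨D'.image fun i : ZMod m => ({v i, v (i + 1)} : Finset V),
        Finset.image_subset_image (Finset.subset_univ _),
        Finset.card_image_of_injective _ hinj, ?_⟩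
      ext i
      simp only [Finset.mem_filter, Finset.mem_univ, true_and]
      exact hinj.mem_finset_image
    -- vbar = 1
    have zz0 : Z {vbar} = z {vbar} := hZ _ (by simp)
    have zz1 : ∀ i, Z {v i} = z {v i} := fun i => hZ _ (by simp)
    have zz2 : ∀ i, Z {vbar, v i} = z {v i, vbar} := fun i => by
      rw [hZ _ (by simp), Finset.pair_comm]
    have zz3 : ∀ i, Z {v i, v (i+1)} = z {v i, v (i+1)} := fun i => hZ _ (by simp)
    have zz4 : ∀ i, Z {vbar, v i, v (i+1)} = z {vbar, v i, v (i+1)} := fun i => hZ _ (by simp)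
    obtain ⟨f1, hf1, e1⟩ := cycle_lemma m hm v hvinj (fun S => Z (insert vbar S)) (fun i => by
      obtain ⟨g, hg, hgZ⟩ := hlocZ (i+1)
      exact ⟨_, hg.ins vbar, fun S hS =>
        hgZ _ ((Finset.insert_subset_insert _ hS).trans (hedC i))⟩) (by
      intro D' hD'
      obtain ⟨D, hD, hc, hf⟩ := hDexists D'
      have := (bridge m hm v hvinj D hD (hc ▸ hD') (fun u => z {u, vbar})
          (fun e => z (insert vbar e)) (z {vbar})).1 (hineq D hD (hc ▸ hD')).1
      rw [hf] at this
      simpa only [zz0, zz2, zz4, insert_empty_eq] using this)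
    obtain ⟨f0, hf0, e0⟩ := cycle_lemma m hm v hvinj (fun S => Z S - Z (insert vbar S))
      (fun i => by
      obtain ⟨g, hg, hgZ⟩ := hlocZ (i+1)
      refine ⟨_, hg.del vbar, fun S hS => ?_⟩
      rw [hgZ _ ((Finset.insert_subset_insert _ hS).trans (hedC i)),
        hgZ _ (hS.trans ((Finset.subset_insert _ _).trans (hedC i)))]) (by
      intro D' hD'
      obtain ⟨D, hD, hc, hf⟩ := hDexists D'
      have := (bridge m hm v hvinj D hD (hc ▸ hD') (fun u => z {u} - z {u, vbar})
          (fun e => z e - z (insert vbar e)) (1 - z {vbar})).1 (hineq D hD (hc ▸ hD')).2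
      rw [hf] at this
      simpa only [zz0, zz1, zz2, zz3, zz4, hZ0, insert_empty_eq] using this)
    -- combine
    have hF := (hf1.pushIns vbar).add (hf0.pushDel vbar)
    have hFe : ∀ i, ∀ S ⊆ insert vbar ({v i, v (i+1)} : Finset V),
        f1 (S.erase vbar) + (if vbar ∈ S then 0 else f0 S) = Z S := by
      intro i S hS
      have hS' : S.erase vbar ⊆ {v i, v (i+1)} := Finset.subset_insert_iff.1 hS
      rw [e1 i _ hS']
      by_cases hb : vbar ∈ S
      · simp [hb, Finset.insert_erase hb]
      · rw [Finset.erase_eq_of_notMem hb] at hS' ⊢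
        rw [if_neg hb, e0 i S hS']
        ring
    -- glue the cliques
    have hglue : ∀ I : Finset (ZMod m), ∃ f, IsMom f ∧
        (∀ i, ∀ S ⊆ insert vbar ({v i, v (i+1)} : Finset V), f S = Z S) ∧
        ∀ i ∈ I, ∀ S ⊆ C i, f S = Z S := by
      intro I
      induction I using Finset.induction_on with
      | empty => exact ⟨_, hF, hFe, by simp⟩
      | insert j I hj ih =>
        obtain ⟨f, hf, hfe, hfC⟩ := ih
        obtain ⟨g, hg, hgZ⟩ := hlocZ j
        obtain ⟨l, rfl⟩ : ∃ l, j = l + 1 := ⟨j - 1, by ring⟩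
        have hsub : (insert vbar (univ.image v) ∪ I.biUnion C) ∩ C (l+1) ⊆
            insert vbar ({v l, v (l+1)} : Finset V) := by
          intro x hx
          rw [Finset.mem_inter, Finset.mem_union, Finset.mem_insert] at hx
          obtain ⟨(rfl | h) | h, hxC⟩ := hx
          · simp
          · obtain ⟨k, _, rfl⟩ := Finset.mem_image.1 h
            by_cases hk : k = l + 1
            · subst hk; simp
            · exact hCC l k hk (Finset.mem_inter.2 ⟨(hvC k).1, hxC⟩)
          · obtain ⟨k, hk, hxk⟩ := Finset.mem_biUnion.1 h
            exact hCC l k (fun hh => hj (hh ▸ hk)) (Finset.mem_inter.2 ⟨hxk, hxC⟩)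
        obtain ⟨k, hk, k1, k2⟩ := glue hf hg (insert vbar (univ.image v) ∪ I.biUnion C) (C (l+1))
          (fun S hS => by
            rw [hfe l S (hS.trans hsub), hgZ S (hS.trans Finset.inter_subset_right)])
        refine ⟨k, hk, fun i S hS => ?_, fun i hi S hS => ?_⟩
        · rw [k1 S, hfe i S hS]
          refine hS.trans (Finset.Subset.trans ?_ Finset.subset_union_left)
          refine Finset.insert_subset_insert _ ?_
          simp [Finset.insert_subset_iff]
        · rcases Finset.mem_insert.1 hi with rfl | hi
          · rw [k2 S hS, hgZ S hS]
          · rw [k1 S, hfC i hi S hS]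
            exact hS.trans ((Finset.subset_biUnion_of_mem C hi).trans Finset.subset_union_right)
    obtain ⟨f, hf, _, hfC⟩ := hglue univ
    refine ⟨f, hf, ?_, ?_, ?_⟩
    · rw [hfC 0 (by simp) _ (by simp), hZ0]
    · intro u hu
      obtain ⟨i, _, hi⟩ := Finset.mem_biUnion.1 hu
      rw [hfC i (by simp) _ (by simpa using hi), hZ _ (by simp)]
    · intro e he
      obtain ⟨i, _, hi⟩ := Finset.mem_biUnion.1 he
      obtain ⟨h1, h2⟩ := hE1 i e hi
      rw [hfC i (by simp) e h1, hZ]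
      exact Finset.card_pos.1 (by omega)
end

section
/- Let the graph G = (V, E) be a chordless cycle K. Then the Boolean quadric polytope BQP(G) equals the set of points z satisfying the standard linearization (0 ≤ z_v ≤ 1 for all v ∈ V; z_e ≥ 0, z_e ≥ z_u + z_v − 1, z_e ≤ z_u, and z_e ≤ z_v for every edge e = {u,v} ∈ E) together with every odd-cycle inequality of K: for every D ⊆ K with |D| odd, ∑_{v∈V_1(D)} z_v − ∑_{v∈V_2(D)} z_v − ∑_{e∈D} z_e + ∑_{e∈K\D} z_e ≤ ⌊|D|/2⌋, where V_1(D) := (∪_{e∈D} e) \ (∪_{e∈K\D} e) and V_2(D) := V(K) \ (∪_{e∈D} e), and V(K) denotes the node set of the cycle K. -/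
open Finset

namespace BQPaux

/-- The two path bounds (even / odd). -/
noncomputable def AB (d : ℕ → ℝ) : ℕ → ℝ × ℝ
  | 0 => (0, 1)
  | k + 1 => (min ((AB d k).1 + d k) ((AB d k).2 + 1 - d k),
              min ((AB d k).2 + d k) ((AB d k).1 + 1 - d k))

noncomputable def val (d : ℕ → ℝ) (F : Finset ℕ) (k : ℕ) : ℝ :=
  ∑ j ∈ range k, if j ∈ F then 1 - d j else d j

lemma val_succ_mem (d : ℕ → ℝ) (F : Finset ℕ) (k : ℕ) (hF : F ⊆ range k) :
    val d (insert k F) (k + 1) = val d F k + (1 - d k) := by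
  unfold val
  rw [sum_range_succ]
  congr 1
  · apply sum_congr rfl
    intro j hj
    have : j ≠ k := by have := mem_range.1 hj; omega
    simp [this]
  · simp

lemma val_succ_not (d : ℕ → ℝ) (F : Finset ℕ) (k : ℕ) (hF : F ⊆ range k) :
    val d F (k + 1) = val d F k + d k := by
  unfold val
  rw [sum_range_succ]
  have : k ∉ F := fun h => by simpa using hF h
  simp [this]

lemma AB_attained (d : ℕ → ℝ) (k : ℕ) (h0 : ∀ j < k, 0 ≤ d j) (h1 : ∀ j < k, d j ≤ 1) :
    ((∃ F ⊆ range k, Even F.card ∧ val d F k ≤ (AB d k).1) ∨ 1 ≤ (AB d k).1) ∧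
    ((∃ F ⊆ range k, Odd F.card ∧ val d F k ≤ (AB d k).2) ∨ 1 ≤ (AB d k).2) := by
  induction k with
  | zero => exact ⟨Or.inl ⟨∅, by simp, by simp, by simp [val, AB]⟩, Or.inr (by simp [AB])⟩
  | succ k ih =>
    obtain ⟨ihA, ihB⟩ := ih (fun j hj => h0 j (by omega)) (fun j hj => h1 j (by omega))
    have h0 := h0 k (by omega)
    have h1 := h1 k (by omega)
    have hss : range k ⊆ range (k+1) := range_subset_range.2 (by omega)
    have hins : ∀ F ⊆ range k, insert k F ⊆ range (k+1) := fun F hF =>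
      insert_subset (by simp) (hF.trans hss)
    have hcard : ∀ F ⊆ range k, (insert k F).card = F.card + 1 := fun F hF =>
      card_insert_of_notMem (fun h => by simpa using hF h)
    constructor
    · rcases min_choice ((AB d k).1 + d k) ((AB d k).2 + 1 - d k) with h | h
      · simp only [AB, h]
        rcases ihA with ⟨F, hF, hc, hv⟩ | hA
        · exact Or.inl ⟨F, hF.trans hss, hc, by rw [val_succ_not d F k hF]; linarith⟩
        · right; linarith
      · simp only [AB, h]
        rcases ihB with ⟨F, hF, hc, hv⟩ | hA
        · exact Or.inl ⟨insert k F, hins F hF, by rw [hcard F hF]; exact hc.add_one,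
            by rw [val_succ_mem d F k hF]; linarith⟩
        · right; linarith
    · rcases min_choice ((AB d k).2 + d k) ((AB d k).1 + 1 - d k) with h | h
      · simp only [AB, h]
        rcases ihB with ⟨F, hF, hc, hv⟩ | hA
        · exact Or.inl ⟨F, hF.trans hss, hc, by rw [val_succ_not d F k hF]; linarith⟩
        · right; linarith
      · simp only [AB, h]
        rcases ihA with ⟨F, hF, hc, hv⟩ | hA
        · exact Or.inl ⟨insert k F, hins F hF, by rw [hcard F hF]; exact hc.add_one,
            by rw [val_succ_mem d F k hF]; linarith⟩
        · right; linarith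

lemma AB_inv (d ζ : ℕ → ℝ) (k : ℕ) (hz : ∀ j ≤ k, 0 ≤ ζ j ∧ ζ j ≤ 1)
    (hd : ∀ j < k, ζ j - ζ (j+1) ≤ d j ∧ ζ (j+1) - ζ j ≤ d j ∧ d j ≤ ζ j + ζ (j+1) ∧
      d j ≤ 2 - ζ j - ζ (j+1)) :
    1 ≤ (AB d k).1 + (AB d k).2 ∧ ζ 0 - ζ k ≤ (AB d k).1 ∧ ζ k - ζ 0 ≤ (AB d k).1 ∧
    1 - (ζ 0 + ζ k) ≤ (AB d k).2 ∧ 1 - (2 - ζ 0 - ζ k) ≤ (AB d k).2 := by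
  induction k with
  | zero =>
    have := hz 0 le_rfl
    simp only [AB]
    refine ⟨?_, ?_, ?_, ?_, ?_⟩ <;> linarith
  | succ k ih =>
    obtain ⟨i1, i2, i3, i4, i5⟩ := ih (fun j hj => hz j (by omega)) (fun j hj => hd j (by omega))
    obtain ⟨d1, d2, d3, d4⟩ := hd k (by omega)
    have := hz (k+1) le_rfl
    have := hz k (by omega)
    simp only [AB]
    rcases min_choice ((AB d k).1 + d k) ((AB d k).2 + 1 - d k) with h | h <;>
    rcases min_choice ((AB d k).2 + d k) ((AB d k).1 + 1 - d k) with h' | h' <;>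
    rw [h, h'] <;> refine ⟨?_, ?_, ?_, ?_, ?_⟩ <;> linarith

/-- conditional probability -/
lemma exists_ratio (p t : ℝ) (h0 : 0 ≤ t) (h1 : t ≤ p) : ∃ r : ℝ, 0 ≤ r ∧ r ≤ 1 ∧ p * r = t := by
  rcases eq_or_lt_of_le (h0.trans h1) with h | h
  · exact ⟨0, le_rfl, zero_le_one, by simp; linarith⟩
  · exact ⟨t / p, by positivity, (div_le_one h).2 h1, by field_simp⟩

/-- triangle lemma. -/
lemma triangle (p00 p01 p10 p11 c u v : ℝ)
    (h1 : max (max 0 (u - p10)) (max (v - p01) (u + v - c)) ≤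
      min (min p11 u) (min v (p00 - c + u + v))) :
    ∃ r00 r01 r10 r11 : ℝ, (0 ≤ r00 ∧ r00 ≤ 1) ∧ (0 ≤ r01 ∧ r01 ≤ 1) ∧ (0 ≤ r10 ∧ r10 ≤ 1) ∧
      (0 ≤ r11 ∧ r11 ≤ 1) ∧ p00 * r00 + p01 * r01 + p10 * r10 + p11 * r11 = c ∧
      p10 * r10 + p11 * r11 = u ∧ p01 * r01 + p11 * r11 = v := by
  obtain ⟨t, ht1, ht2⟩ : ∃ t, max (max 0 (u - p10)) (max (v - p01) (u + v - c)) ≤ t ∧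
      t ≤ min (min p11 u) (min v (p00 - c + u + v)) := ⟨_, le_rfl, h1⟩
  simp only [max_le_iff, le_min_iff] at ht1 ht2
  obtain ⟨⟨a1, a2⟩, a3, a4⟩ := ht1
  obtain ⟨⟨b1, b2⟩, b3, b4⟩ := ht2
  obtain ⟨r11, x1, x2, x3⟩ := exists_ratio p11 t (by linarith) (by linarith)
  obtain ⟨r10, y1, y2, y3⟩ := exists_ratio p10 (u - t) (by linarith) (by linarith)
  obtain ⟨r01, z1, z2, z3⟩ := exists_ratio p01 (v - t) (by linarith) (by linarith)
  obtain ⟨r00, w1, w2, w3⟩ := exists_ratio p00 (c - u - v + t) (by linarith) (by linarith)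
  exact ⟨r00, r01, r10, r11, ⟨w1, w2⟩, ⟨z1, z2⟩, ⟨y1, y2⟩, ⟨x1, x2⟩, by linarith, by linarith,
    by linarith⟩

lemma exists_mid (a b c d x A B : ℝ) (ha : 0 ≤ a ∧ a ≤ 1) (hb : 0 ≤ b ∧ b ≤ 1)
    (hc : 0 ≤ c ∧ c ≤ 1)
    (hd : b - c ≤ d ∧ c - b ≤ d ∧ d ≤ b + c ∧ d ≤ 2 - b - c)
    (hx : a - c ≤ x ∧ c - a ≤ x ∧ x ≤ a + c ∧ x ≤ 2 - a - c)
    (hAB : 1 ≤ A + B ∧ a - b ≤ A ∧ b - a ≤ A ∧ 1 - (a + b) ≤ B ∧ 1 - (2 - a - b) ≤ B)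
    (hA : x ≤ min (A + d) (B + 1 - d)) (hB : 1 - min (B + d) (A + 1 - d) ≤ x) :
    ∃ y, (1 - B ≤ y ∧ y ≤ A) ∧ (a - b ≤ y ∧ b - a ≤ y ∧ y ≤ a + b ∧ y ≤ 2 - a - b) ∧
      (x - d ≤ y ∧ d - x ≤ y ∧ y ≤ x + d ∧ y ≤ 2 - x - d) := by
  have hB' : 1 - x ≤ min (B + d) (A + 1 - d) := by linarith
  simp only [le_min_iff] at hA hB'
  obtain ⟨t, ht1, ht2⟩ : ∃ t, max (max (1 - B) (a - b)) (max (b - a) (max (x - d) (d - x))) ≤ t ∧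
      t ≤ min (min A (a + b)) (min (2 - a - b) (min (x + d) (2 - x - d))) := by
    refine ⟨_, le_rfl, ?_⟩
    simp only [max_le_iff, le_min_iff]
    refine ⟨⟨⟨⟨?_, ?_⟩, ?_, ?_, ?_⟩, ⟨?_, ?_⟩, ?_, ?_, ?_⟩, ⟨⟨?_, ?_⟩, ?_, ?_, ?_⟩,
      ⟨⟨?_, ?_⟩, ?_, ?_, ?_⟩, ⟨⟨?_, ?_⟩, ?_, ?_, ?_⟩⟩ <;> linarith
  simp only [max_le_iff, le_min_iff] at ht1 ht2
  exact ⟨t, by tauto⟩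

lemma realize (ε ζ d : ℕ → ℝ) (hdef : ∀ j, d j = ζ j + ζ (j+1) - 2 * ε j) (k : ℕ)
    (hz : ∀ j ≤ k, 0 ≤ ζ j ∧ ζ j ≤ 1)
    (hd : ∀ j < k, ζ j - ζ (j+1) ≤ d j ∧ ζ (j+1) - ζ j ≤ d j ∧ d j ≤ ζ j + ζ (j+1) ∧
      d j ≤ 2 - ζ j - ζ (j+1)) (x : ℝ) (hx : ζ 0 - ζ k ≤ x ∧ ζ k - ζ 0 ≤ x ∧ x ≤ ζ 0 + ζ k ∧
      x ≤ 2 - ζ 0 - ζ k) (hA : x ≤ (AB d k).1) (hB : 1 - (AB d k).2 ≤ x) :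
    ∃ (ι : Type) (_ : Fintype ι) (w : ι → ℝ) (s : ℕ → ι → ℝ), (∀ i, 0 ≤ w i) ∧ ∑ i, w i = 1 ∧
      (∀ j i, s j i = 0 ∨ s j i = 1) ∧ (∀ j ≤ k, ∑ i, w i * s j i = ζ j) ∧
      (∀ j < k, ∑ i, w i * (s j i * s (j+1) i) = ε j) ∧
      ∑ i, w i * (s 0 i * s k i) = (ζ 0 + ζ k - x) / 2 := by
  induction k generalizing x with
  | zero =>
    simp only [AB] at hA hB
    have := hz 0 le_rfl
    refine ⟨Bool, inferInstance, fun b => if b then ζ 0 else 1 - ζ 0,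
      fun _ b => if b then 1 else 0, ?_, by simp, ?_, ?_, ?_, ?_⟩
    · intro b; cases b <;> simp <;> linarith
    · intro j b; cases b <;> simp
    · intro j hj; obtain rfl : j = 0 := by omega
      simp
    · intro j hj; omega
    · simp; linarith
  | succ k ih =>
    have hz' : ∀ j ≤ k, 0 ≤ ζ j ∧ ζ j ≤ 1 := fun j hj => hz j (by omega)
    have hd' := fun j (hj : j < k) => hd j (by omega)
    obtain ⟨y, ⟨y1, y2⟩, hy, ht1, ht2, ht3, ht4⟩ := exists_mid (ζ 0) (ζ k) (ζ (k+1)) (d k) x _ _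
      (hz 0 (by omega)) (hz k (by omega)) (hz (k+1) (by omega)) (hd k (by omega)) hx
      (AB_inv d ζ k hz' hd') hA hB
    obtain ⟨ι, _, w, s, w0, w1, s01, hs, he, hc⟩ := ih hz' hd' y hy y2 y1
    have hdk := hdef k
    obtain ⟨hd1, hd2, hd3, hd4⟩ := hd k (by omega)
    obtain ⟨hx1, hx2, hx3, hx4⟩ := hx
    obtain ⟨hy1, hy2, hy3, hy4⟩ := hy
    set p := (ζ 0 + ζ k - y) / 2 with hp
    obtain ⟨r00, r01, r10, r11, hr00, hr01, hr10, hr11, e1, e2, e3⟩ :=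
      triangle (1 - ζ 0 - ζ k + p) (ζ k - p) (ζ 0 - p) p (ζ (k+1))
        ((ζ 0 + ζ (k+1) - x) / 2) (ε k) (by
          have := hz 0 (by omega)
          have := hz k (by omega)
          have := hz (k+1) (by omega)
          simp only [max_le_iff, le_min_iff]
          refine ⟨⟨⟨⟨?_, ?_⟩, ?_, ?_⟩, ⟨?_, ?_⟩, ?_, ?_⟩, ⟨⟨?_, ?_⟩, ?_, ?_⟩,
            ⟨⟨?_, ?_⟩, ?_, ?_⟩⟩ <;> linarith)
    let q : ι → ℝ := fun i => r00 + (r10 - r00) * s 0 i + (r01 - r00) * s k i +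
      (r11 - r10 - r01 + r00) * (s 0 i * s k i)
    have hq : ∀ i, 0 ≤ q i ∧ q i ≤ 1 := by
      intro i
      rcases s01 0 i with h | h <;> rcases s01 k i with h' | h' <;> simp only [q, h, h'] <;>
        constructor <;> linarith
    have hsq : ∀ j i, s j i * s j i = s j i := by
      intro j i; rcases s01 j i with h | h <;> simp [h]
    have hs0 := hs 0 (by omega)
    have hsk := hs k le_rfl
    refine ⟨ι × Bool, inferInstance, fun b => w b.1 * (if b.2 then q b.1 else 1 - q b.1),
      fun j b => if j = k + 1 then (if b.2 then 1 else 0) else s j b.1, ?_, ?_, ?_, ?_, ?_, ?_⟩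
    · rintro ⟨i, b⟩
      have := hq i
      apply mul_nonneg (w0 i)
      cases b <;> simp <;> linarith
    · rw [Fintype.sum_prod_type]
      refine Eq.trans ?_ w1
      apply sum_congr rfl
      intro i _
      simp; ring
    · rintro j ⟨i, b⟩
      by_cases h : j = k + 1
      · cases b <;> simp [h]
      · simpa [h] using s01 j i
    · intro j hj
      rw [Fintype.sum_prod_type]
      by_cases h : j = k + 1
      · subst h
        calc _ = ∑ i, (r00 * w i + (r10 - r00) * (w i * s 0 i) + (r01 - r00) * (w i * s k i) +
              (r11 - r10 - r01 + r00) * (w i * (s 0 i * s k i))) := by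
              apply sum_congr rfl; intro i _; simp [q]; ring
          _ = _ := by
            simp only [sum_add_distrib, ← mul_sum]
            rw [w1, hs0, hsk, hc]; linarith
      · rw [← hs j (by omega)]
        apply sum_congr rfl; intro i _; simp [h]; ring
    · intro j hj
      rw [Fintype.sum_prod_type]
      by_cases h : j = k
      · subst h
        calc _ = ∑ i, (r01 * (w i * s j i) +
              (r11 - r01) * (w i * (s 0 i * s j i))) := by
              apply sum_congr rfl; intro i _; simp [q]
              linear_combination (w i * (r01 - r00) + w i * (r11 - r10 - r01 + r00) * s 0 i) * hsq j i
          _ = _ := by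
            simp only [sum_add_distrib, ← mul_sum]
            rw [hsk, hc]; linarith
      · rw [← he j (by omega)]
        have : j ≠ k + 1 := by omega
        apply sum_congr rfl; intro i _; simp [h, this]; ring
    · rw [Fintype.sum_prod_type]
      calc _ = ∑ i, (r10 * (w i * s 0 i) +
              (r11 - r10) * (w i * (s 0 i * s k i))) := by
              apply sum_congr rfl; intro i _; simp [q]
              linear_combination (w i * (r10 - r00) + w i * (r11 - r10 - r01 + r00) * s k i) * hsq 0 i
          _ = _ := by
            simp only [sum_add_distrib, ← mul_sum]
            rw [hs0, hc]; linarith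

variable {m : ℕ} [NeZero m]

lemma one_ne (hm : 3 ≤ m) : (1 : ZMod m) ≠ 0 := by
  intro h
  have : ((1 : ℕ) : ZMod m) = 0 := by simpa using h
  rw [ZMod.natCast_eq_zero_iff] at this
  have := Nat.le_of_dvd (by omega) this
  omega

lemma two_ne (hm : 3 ≤ m) : (1 + 1 : ZMod m) ≠ 0 := by
  intro h
  have : ((2 : ℕ) : ZMod m) = 0 := by rw [← h]; push_cast; ring
  rw [ZMod.natCast_eq_zero_iff] at this
  have := Nat.le_of_dvd (by omega) this
  omega

lemma edge_inj (hm : 3 ≤ m) :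
    Function.Injective fun i : ZMod m => ({i, i + 1} : Finset (ZMod m)) := by
  intro i j h
  simp only at h
  have h1 : i ∈ ({j, j + 1} : Finset (ZMod m)) := h ▸ by simp
  have h2 : i + 1 ∈ ({j, j + 1} : Finset (ZMod m)) := h ▸ by simp
  simp only [mem_insert, mem_singleton] at h1 h2
  rcases h1 with h1 | h1
  · exact h1
  · rcases h2 with h2 | h2
    · exact absurd (by linear_combination h2 - h1) (two_ne hm)
    · linear_combination h2

noncomputable def dd (z : Finset (ZMod m) → ℝ) (i : ZMod m) : ℝ :=
  z {i} + z {i + 1} - 2 * z {i, i + 1}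

noncomputable def cyc (z : Finset (ZMod m) → ℝ) (F : Finset (ZMod m)) : ℝ :=
  ∑ i, if i ∈ F then 1 - dd z i else dd z i

abbrev KK (m : ℕ) [NeZero m] : Finset (Finset (ZMod m)) :=
  Finset.univ.image fun i : ZMod m => ({i, i + 1} : Finset (ZMod m))

lemma cyc_eq (hm : 3 ≤ m) (z : Finset (ZMod m) → ℝ) (F : Finset (ZMod m)) (D : Finset (Finset (ZMod m)))
    (hD : D = F.image fun i : ZMod m => ({i, i + 1} : Finset (ZMod m))) :
    2 * ((∑ u ∈ D.biUnion id \ (KK m \ D).biUnion id, z {u}) -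
      (∑ u ∈ Finset.univ \ D.biUnion id, z {u}) - (∑ e ∈ D, z e) + (∑ e ∈ KK m \ D, z e))
      = F.card - cyc z F := by
  have hinj := edge_inj hm
  have hK : KK m \ D = Fᶜ.image fun i : ZMod m => ({i, i + 1} : Finset (ZMod m)) := by
    rw [hD, KK, ← image_sdiff _ _ hinj]
    rfl
  have hu : ∀ (F : Finset (ZMod m)) v, v ∈ (F.image fun i : ZMod m =>
      ({i, i + 1} : Finset (ZMod m))).biUnion id ↔ v ∈ F ∨ v - 1 ∈ F := by
    intro F v
    simp only [mem_biUnion, mem_image, id]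
    constructor
    · rintro ⟨_, ⟨i, hi, rfl⟩, hv⟩
      simp only [mem_insert, mem_singleton] at hv
      rcases hv with rfl | rfl
      · exact Or.inl hi
      · right; simpa using hi
    · rintro (h | h)
      · exact ⟨_, ⟨v, h, rfl⟩, by simp⟩
      · exact ⟨_, ⟨v - 1, h, rfl⟩, by simp⟩
  have hV1 : D.biUnion id \ (KK m \ D).biUnion id = univ.filter fun v => v ∈ F ∧ v - 1 ∈ F := by
    ext v
    rw [mem_sdiff, hK, hD, hu, hu]
    simp only [mem_compl, mem_filter, mem_univ, true_and]
    tauto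
  have hV2 : Finset.univ \ D.biUnion id = univ.filter fun v => v ∉ F ∧ v - 1 ∉ F := by
    ext v
    rw [mem_sdiff, hD, hu]
    simp only [mem_filter, mem_univ, true_and]
    tauto
  rw [hV1, hV2, hK, hD, sum_image hinj.injOn, sum_image hinj.injOn]
  let σ : ZMod m → ℝ := fun i => if i ∈ F then 1 else -1
  have hshift : ∑ i, σ i * z {i + 1} = ∑ i, σ (i - 1) * z {i} := by
    rw [← Equiv.sum_comp (Equiv.addRight (1 : ZMod m)) (fun i => σ (i - 1) * z {i})]
    simp
  have h1 : 2 * ((∑ u ∈ univ.filter fun v => v ∈ F ∧ v - 1 ∈ F, z {u}) -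
      ∑ u ∈ univ.filter fun v => v ∉ F ∧ v - 1 ∉ F, z {u}) = ∑ i, σ i * z {i} + ∑ i, σ (i - 1) * z {i} := by
    rw [sum_filter, sum_filter, ← sum_sub_distrib, mul_sum, ← sum_add_distrib]
    apply sum_congr rfl
    intro i _
    by_cases h : i ∈ F <;> by_cases h' : i - 1 ∈ F <;> simp [σ, h, h'] <;> ring
  have h2 : 2 * (-(∑ i ∈ F, z {i, i + 1}) + ∑ i ∈ Fᶜ, z {i, i+1}) = ∑ i, - (2 * (σ i * z {i, i + 1})) := by
    rw [← sum_add_sum_compl F (fun i => - (2 * (σ i * z {i, i + 1}))), mul_add, mul_neg, mul_sum, mul_sum,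
      ← sum_neg_distrib]
    congr 1
    · apply sum_congr rfl; intro i hi; simp [σ, hi]
    · apply sum_congr rfl; intro i hi; simp [σ, mem_compl.1 hi]
  have h3 : cyc z F = F.card - (∑ i, σ i * z {i} + ∑ i, σ i * z {i + 1} + ∑ i, - (2 * (σ i * z {i, i + 1}))) := by
    have : (F.card : ℝ) = ∑ i, if i ∈ F then 1 else 0 := by simp
    rw [this, ← sum_add_distrib, ← sum_add_distrib, ← sum_sub_distrib]
    apply sum_congr rfl
    intro i _
    by_cases h : i ∈ F <;> simp [σ, h, dd] <;> ring
  rw [h3, hshift]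
  linarith

def Q (m : ℕ) [NeZero m] : Set (Finset (ZMod m) → ℝ) :=
  {z | (∀ u : ZMod m, 0 ≤ z {u} ∧ z {u} ≤ 1) ∧
        (∀ i : ZMod m, 0 ≤ z {i, i + 1} ∧ z {i} + z {i + 1} - 1 ≤ z {i, i + 1} ∧
          z {i, i + 1} ≤ z {i} ∧ z {i, i + 1} ≤ z {i + 1}) ∧
        ∀ F : Finset (ZMod m), Odd F.card → 1 ≤ cyc z F}

lemma cyc_comb (x y : Finset (ZMod m) → ℝ) (F : Finset (ZMod m)) (a b : ℝ) (hab : a + b = 1) :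
    cyc (a • x + b • y) F = a * cyc x F + b * cyc y F := by
  unfold cyc
  rw [mul_sum, mul_sum, ← sum_add_distrib]
  apply sum_congr rfl
  intro i _
  by_cases h : i ∈ F <;> simp [h, dd]
  · linear_combination -hab
  · ring

lemma Q_convex : Convex ℝ (Q m) := by
  rintro x ⟨hx1, hx2, hx3⟩ y ⟨hy1, hy2, hy3⟩ a b ha hb hab
  refine ⟨?_, ?_, ?_⟩
  · intro u
    have := hx1 u
    have := hy1 u
    simp only [Pi.add_apply, Pi.smul_apply, smul_eq_mul]
    constructor <;> nlinarith
  · intro u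
    obtain ⟨p1, p2, p3, p4⟩ := hx2 u
    obtain ⟨q1, q2, q3, q4⟩ := hy2 u
    simp only [Pi.add_apply, Pi.smul_apply, smul_eq_mul]
    refine ⟨by positivity, ?_, ?_, ?_⟩
    · linarith [mul_le_mul_of_nonneg_left p2 ha, mul_le_mul_of_nonneg_left q2 hb]
    · linarith [mul_le_mul_of_nonneg_left p3 ha, mul_le_mul_of_nonneg_left q3 hb]
    · linarith [mul_le_mul_of_nonneg_left p4 ha, mul_le_mul_of_nonneg_left q4 hb]
  · intro F hF
    rw [cyc_comb _ _ _ _ _ hab]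
    linarith [mul_le_mul_of_nonneg_left (hx3 F hF) ha, mul_le_mul_of_nonneg_left (hy3 F hF) hb]

lemma point_mem (z : Finset (ZMod m) → ℝ) (x : ZMod m → ℝ) (hx : ∀ u, x u = 0 ∨ x u = 1)
    (h1 : ∀ u, z {u} = x u) (h2 : ∀ i : ZMod m, z {i, i + 1} = x i * x (i + 1)) : z ∈ Q m := by
  refine ⟨?_, ?_, ?_⟩
  · intro u; rw [h1]; rcases hx u with h | h <;> simp [h]
  · intro u; rw [h1, h1, h2]
    rcases hx u with h | h <;> rcases hx (u+1) with h' | h' <;> simp [h, h']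
  · intro F hF
    have : ∀ u, ∃ n : ℤ, x u = n ∧ (n = 0 ∨ n = 1) := by
      intro u
      rcases hx u with h | h
      · exact ⟨0, by simp [h], by simp⟩
      · exact ⟨1, by simp [h], by simp⟩
    choose X hX hX01 using this
    let δ : ZMod m → ℤ := fun i => X i + X (i+1) - 2 * (X i * X (i+1))
    have hδ : ∀ i, dd z i = δ i := by
      intro i; simp [dd, δ, h1, h2, hX]
    have hδ01 : ∀ i, 0 ≤ δ i ∧ δ i ≤ 1 := by
      intro i
      rcases hX01 i with h | h <;> rcases hX01 (i+1) with h' | h' <;> simp [δ, h, h']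
    let S : ℤ := ∑ i, if i ∈ F then 1 - δ i else δ i
    have hS : cyc z F = S := by
      simp only [cyc, S, hδ]
      push_cast
      rfl
    have hS0 : 0 ≤ S := by
      apply sum_nonneg
      intro i _
      have := hδ01 i
      split_ifs <;> linarith
    have hshift : ∑ i, X (i + 1) = ∑ i, X i := Equiv.sum_comp (Equiv.addRight (1 : ZMod m)) X
    have hpar : S = F.card + 2 * (∑ i, X i - ∑ i, X i * X (i+1) - ∑ i, if i ∈ F then δ i else 0) := by
      have hc : (F.card : ℤ) = ∑ i, if i ∈ F then 1 else 0 := by simp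
      have : 2 * ∑ i, X i = ∑ i, X i + ∑ i, X (i+1) := by rw [hshift]; ring
      rw [mul_sub, mul_sub, this, hc, mul_sum, mul_sum, ← sum_add_distrib, ← sum_sub_distrib,
        ← sum_sub_distrib, ← sum_add_distrib]
      apply sum_congr rfl
      intro i _
      by_cases h : i ∈ F <;> simp [h, δ] <;> ring
    have : 1 ≤ S := by
      obtain ⟨k, hk⟩ := hF
      rw [hk] at hpar
      push_cast at hpar
      omega
    rw [hS]
    exact_mod_cast this

lemma sum_zmod (f : ZMod m → ℝ) : ∑ i, f i = ∑ j ∈ range m, f (j : ZMod m) := by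
  apply sum_nbij' (fun i : ZMod m => i.val) (fun j : ℕ => (j : ZMod m))
  · intro i _; simpa using ZMod.val_lt i
  · intro j _; simp
  · intro i _; simp
  · intro j hj; exact ZMod.val_cast_of_lt (mem_range.1 hj)
  · intro i _; simp

lemma mem_hull (hm : 3 ≤ m) (z : Finset (ZMod m) → ℝ) (hz : z ∈ Q m) :
    z ∈ convexHull ℝ {z : Finset (ZMod m) → ℝ | ∃ x : ZMod m → ℝ,
        (∀ u, x u = 0 ∨ x u = 1) ∧ (∀ u, z {u} = x u) ∧
        ∀ i : ZMod m, z {i, i + 1} = x i * x (i + 1)} := by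
  obtain ⟨h1, h2, h3⟩ := hz
  let ζ : ℕ → ℝ := fun j => z {(j : ZMod m)}
  let ε : ℕ → ℝ := fun j => z {(j : ZMod m), (j : ZMod m) + 1}
  let d : ℕ → ℝ := fun j => dd z (j : ZMod m)
  have hdef : ∀ j, d j = ζ j + ζ (j+1) - 2 * ε j := by
    intro j; simp [d, ζ, ε, dd]
  have hζ : ∀ j, 0 ≤ ζ j ∧ ζ j ≤ 1 := fun j => h1 _
  have hd : ∀ j, ζ j - ζ (j+1) ≤ d j ∧ ζ (j+1) - ζ j ≤ d j ∧ d j ≤ ζ j + ζ (j+1) ∧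
      d j ≤ 2 - ζ j - ζ (j+1) := by
    intro j
    rw [hdef]
    have := h2 j
    have e : ζ (j+1) = z {(j : ZMod m) + 1} := by simp [ζ]
    simp only [e, ζ, ε]
    refine ⟨?_, ?_, ?_, ?_⟩ <;> linarith
  have hcyc : 1 ≤ (AB d m).2 := by
    rcases (AB_attained d m (fun j _ => by linarith [hd j]) (fun j _ => by linarith [hd j])).2 with
      ⟨F, hF, hc, hv⟩ | h
    · refine le_trans ?_ hv
      have hinj : Set.InjOn (fun j : ℕ => (j : ZMod m)) (range m) := by
        intro a ha b hb hab
        have ha := mem_range.1 ha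
        have hb := mem_range.1 hb
        have := congrArg ZMod.val hab
        simpa [ZMod.val_cast_of_lt ha, ZMod.val_cast_of_lt hb] using this
      have := h3 (F.image fun j : ℕ => (j : ZMod m)) (by
        rwa [card_image_of_injOn (hinj.mono (by exact_mod_cast hF))])
      refine this.trans (le_of_eq ?_)
      unfold cyc val
      rw [sum_zmod]
      apply sum_congr rfl
      intro j hj
      have : (j : ZMod m) ∈ F.image (fun j : ℕ => (j : ZMod m)) ↔ j ∈ F := by
        constructor
        · intro h
          obtain ⟨a, ha, hb⟩ := mem_image.1 h
          rwa [← hinj (hF ha) hj hb]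
        · exact fun h => mem_image_of_mem _ h
      simp only [this, d]
    · exact h
  obtain ⟨n, hn⟩ : ∃ n, m = n + 1 := ⟨m - 1, by omega⟩
  have hzm : ζ (n + 1) = ζ 0 := by simp only [ζ, ← hn]; simp
  have hdn := hd n
  rw [hzm] at hdn
  have hcyc' : 1 ≤ (AB d (n+1)).2 := by rw [← hn]; exact hcyc
  simp only [AB, le_min_iff] at hcyc'
  obtain ⟨ι, _, w, s, w0, w1, s01, hs, he, hc⟩ := realize ε ζ d hdef n (fun j _ => hζ j)
    (fun j _ => hd j) (d n) ⟨by linarith, by linarith, by linarith, by linarith⟩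
    (by linarith) (by linarith)
  have hc' : ∑ i, w i * (s n i * s 0 i) = ε n := by
    have e := hdef n
    rw [hzm] at e
    simp only [mul_comm (s n _)]
    rw [hc]; linarith
  classical
  let Z : ι → Finset (ZMod m) → ℝ := fun i F =>
    if (∃ u, F = {u}) ∨ (∃ u, F = {u, u + 1}) then ∏ u ∈ F, s u.val i else z F
  have hne : ∀ u : ZMod m, u ∉ ({u + 1} : Finset (ZMod m)) := by
    intro u h
    rw [mem_singleton] at h
    exact one_ne hm (by linear_combination -h)
  have hZ1 : ∀ i u, Z i {u} = s u.val i := by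
    intro i u
    simp only [Z]
    rw [if_pos (Or.inl ⟨u, rfl⟩), prod_singleton]
  have hZ2 : ∀ i u, Z i {u, u+1} = s u.val i * s (u+1).val i := by
    intro i u
    simp only [Z]
    rw [if_pos (Or.inr ⟨u, rfl⟩), prod_insert (hne u), prod_singleton]
  have hsum : z = ∑ i, w i • Z i := by
    ext F
    simp only [Finset.sum_apply, Pi.smul_apply, smul_eq_mul]
    by_cases hF : (∃ u, F = {u}) ∨ (∃ u, F = {u, u + 1})
    · rcases hF with ⟨u, rfl⟩ | ⟨u, rfl⟩
      · simp only [hZ1]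
        have := ZMod.val_lt u
        rw [hs u.val (by omega)]
        simp [ζ]
      · simp only [hZ2]
        have hu := ZMod.val_lt u
        have hεu : z {u, u + 1} = ε u.val := by simp [ε]
        rw [hεu]
        by_cases h : u.val = n
        · have : (u + 1).val = 0 := by
            have : u + 1 = 0 := by
              rw [← ZMod.natCast_zmod_val u, h]
              have : ((n + 1 : ℕ) : ZMod m) = 0 := by rw [← hn]; simp
              simpa using this
            rw [this]; simp
          rw [this, h, hc']
        · have : (u + 1).val = u.val + 1 := by
            have e : u + 1 = ((u.val + 1 : ℕ) : ZMod m) := by simp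
            rw [e, ZMod.val_cast_of_lt (by omega)]
          rw [this, he u.val (by omega)]
    · have : ∀ i, Z i F = z F := fun i => if_neg hF
      simp only [this, ← sum_mul, w1, one_mul]
  rw [hsum]
  apply (convex_convexHull ℝ _).sum_mem (fun i _ => w0 i) w1
  intro i _
  apply subset_convexHull
  exact ⟨fun u => s u.val i, fun u => s01 _ _, hZ1 i, hZ2 i⟩

end BQPaux

/-- Padberg: for a chordless cycle `K` (here the cycle on `ZMod m`, `m ≥ 3`,
with edges `{i, i+1}`), the Boolean quadric polytope equals the standard linearization
together with all odd-cycle inequalities of `K`. Points are indexed by `Finset (ZMod m)`: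
node coordinates are `z {u}` and edge coordinates `z {i, i+1}`. -/
theorem boolean_quadric_polytope_chordless_cycle (m : ℕ) [NeZero m] (hm : 3 ≤ m) :
    convexHull ℝ {z : Finset (ZMod m) → ℝ | ∃ x : ZMod m → ℝ,
        (∀ u, x u = 0 ∨ x u = 1) ∧ (∀ u, z {u} = x u) ∧
        ∀ i : ZMod m, z {i, i + 1} = x i * x (i + 1)} =
      {z : Finset (ZMod m) → ℝ |
        (∀ u : ZMod m, 0 ≤ z {u} ∧ z {u} ≤ 1) ∧
        (∀ i : ZMod m, 0 ≤ z {i, i + 1} ∧ z {i} + z {i + 1} - 1 ≤ z {i, i + 1} ∧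
          z {i, i + 1} ≤ z {i} ∧ z {i, i + 1} ≤ z {i + 1}) ∧
        ∀ D ⊆ Finset.univ.image fun i : ZMod m => ({i, i + 1} : Finset (ZMod m)),
          Odd D.card →
            (letI K : Finset (Finset (ZMod m)) :=
                Finset.univ.image fun i : ZMod m => ({i, i + 1} : Finset (ZMod m))
             letI V1 : Finset (ZMod m) := D.biUnion id \ (K \ D).biUnion id
             letI V2 : Finset (ZMod m) := Finset.univ \ D.biUnion id
             (∑ u ∈ V1, z {u}) - (∑ u ∈ V2, z {u}) - (∑ e ∈ D, z e) + (∑ e ∈ K \ D, z e) ≤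
               ((D.card / 2 : ℕ) : ℝ))} := by
  rw [show {z : Finset (ZMod m) → ℝ |
        (∀ u : ZMod m, 0 ≤ z {u} ∧ z {u} ≤ 1) ∧
        (∀ i : ZMod m, 0 ≤ z {i, i + 1} ∧ z {i} + z {i + 1} - 1 ≤ z {i, i + 1} ∧
          z {i, i + 1} ≤ z {i} ∧ z {i, i + 1} ≤ z {i + 1}) ∧
        ∀ D ⊆ Finset.univ.image fun i : ZMod m => ({i, i + 1} : Finset (ZMod m)),
          Odd D.card → _} = BQPaux.Q m from ?_]
  · apply Set.Subset.antisymm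
    · apply convexHull_min _ BQPaux.Q_convex
      rintro z ⟨x, hx, h1, h2⟩
      exact BQPaux.point_mem z x hx h1 h2
    · exact fun z hz => BQPaux.mem_hull hm z hz
  · ext z
    simp only [BQPaux.Q, Set.mem_setOf_eq]
    refine and_congr_right fun _ => and_congr_right fun _ => ?_
    have hdiv : ∀ n : ℕ, Odd n → 2 * ((n / 2 : ℕ) : ℝ) = n - 1 := by
      rintro n ⟨k, rfl⟩
      rw [show (2 * k + 1) / 2 = k by omega]
      push_cast; ring
    constructor
    · intro h F hF
      have hcard := card_image_of_injective F (BQPaux.edge_inj hm)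
      have hF' : Odd (F.image fun i : ZMod m => ({i, i + 1} : Finset (ZMod m))).card := by
        rwa [hcard]
      have h' := h _ (image_subset_image (subset_univ F)) hF'
      have e := BQPaux.cyc_eq hm z F _ rfl
      have e2 := hdiv _ hF'
      rw [hcard] at e2 h'
      linarith
    · intro h D hD hodd
      obtain ⟨F, -, rfl⟩ := subset_image_iff.1 hD
      have hcard := card_image_of_injective F (BQPaux.edge_inj hm)
      have e := BQPaux.cyc_eq hm z F _ rfl
      have e2 := hdiv _ hodd
      rw [hcard] at e2 hodd ⊢
      have := h F hodd
      linarith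
end
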